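/- arXiv:math/0309364 — 3 statements merged into one kernel-verified Lean document; each statement's English description precedes it below -/
import Mathlib

section
/- Let q ∈ F with q ≠ 0 and q ≠ 1, let K be a convex subset of W containing the identity element, and let ρ : S → End_F(V_K) be a map satisfying Axiom (B) together with the Hecke relations (ρ_s − 1)(ρ_s + q) = 0 for all s ∈ S, and assume ȧ_t ≠ 0, ḃ_t ≠ 0, b̈_t ≠ 0 for all t ∈ T_K. Let s,t ∈ S with m(s,t) = 3. Then ρ_sρ_tρ_s = ρ_tρ_sρ_t if and only if both of the following hold: (a) for every w ∈ K with ℓ(w) < ℓ(ws), ℓ(w) < ℓ(wt), and such that ws ∈ K or wt ∈ K: ḋ_{wstsw⁻¹} = ḋ_{wsw⁻¹} · ḋ_{wtw⁻¹}; (b) for every w ∈ K with ws ∉ K and wt ∉ K: ḋ_{wsw⁻¹} = ḋ_{wtw⁻¹} ∈ {q, q⁻¹}. -/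
open CoxeterSystem

variable {B W : Type*} [Group W] {M : CoxeterMatrix B}

/-- The basis vector `C_w` of the vector space `V_K` spanned by `{C_w : w ∈ K}`,
realized as finitely supported functions on the subtype `K`. -/
noncomputable def Cvec (F : Type*) [Field F] (K : Set W) (w : W) (hw : w ∈ K) : ↥K →₀ F :=
  Finsupp.single ⟨w, hw⟩ 1

/-- `T_K`: reflections of the form `w s w⁻¹` with `w ∈ K` and `ws ∈ K`. -/
def TK (cs : CoxeterSystem M W) (K : Set W) : Set W :=
  {t | ∃ (i : B) (w : W), w ∈ K ∧ w * cs.simple i ∈ K ∧ t = w * cs.simple i * w⁻¹}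

/-- `T_∂K`: reflections of the form `w s w⁻¹` with `w ∈ K` and `ws ∉ K`. -/
def TbK (cs : CoxeterSystem M W) (K : Set W) : Set W :=
  {t | ∃ (i : B) (w : W), w ∈ K ∧ w * cs.simple i ∉ K ∧ t = w * cs.simple i * w⁻¹}

/-- A map `ρ : S → End_F(V_K)` satisfying Axiom (B), together with its coefficient data
`ȧ, ä, ḃ, b̈` (functions of the reflection `w s w⁻¹`). -/
structure AxiomBMap (cs : CoxeterSystem M W) (F : Type*) [Field F] (K : Set W) where
  ρ : B → Module.End F (↥K →₀ F)
  ad : W → F  -- ȧ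
  aBar : W → F  -- ä
  bd : W → F  -- ḃ
  bBar : W → F  -- b̈
  axiomB_lt_mem : ∀ (i : B) (w : W) (hw : w ∈ K) (h : w * cs.simple i ∈ K),
    cs.length w < cs.length (w * cs.simple i) →
    ρ i (Cvec F K w hw) = ad (w * cs.simple i * w⁻¹) • Cvec F K w hw +
      bd (w * cs.simple i * w⁻¹) • Cvec F K (w * cs.simple i) h
  axiomB_lt_not_mem : ∀ (i : B) (w : W) (hw : w ∈ K), w * cs.simple i ∉ K →
    cs.length w < cs.length (w * cs.simple i) →
    ρ i (Cvec F K w hw) = ad (w * cs.simple i * w⁻¹) • Cvec F K w hw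
  axiomB_gt_mem : ∀ (i : B) (w : W) (hw : w ∈ K) (h : w * cs.simple i ∈ K),
    cs.length (w * cs.simple i) < cs.length w →
    ρ i (Cvec F K w hw) = aBar (w * cs.simple i * w⁻¹) • Cvec F K w hw +
      bBar (w * cs.simple i * w⁻¹) • Cvec F K (w * cs.simple i) h
  axiomB_gt_not_mem : ∀ (i : B) (w : W) (hw : w ∈ K), w * cs.simple i ∉ K →
    cs.length (w * cs.simple i) < cs.length w →
    ρ i (Cvec F K w hw) = aBar (w * cs.simple i * w⁻¹) • Cvec F K w hw
  bd_eq_zero : ∀ (i : B) (w : W), w ∈ K → w * cs.simple i ∉ K →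
    cs.length w < cs.length (w * cs.simple i) → bd (w * cs.simple i * w⁻¹) = 0
  bBar_eq_zero : ∀ (i : B) (w : W), w ∈ K → w * cs.simple i ∉ K →
    cs.length (w * cs.simple i) < cs.length w → bBar (w * cs.simple i * w⁻¹) = 0

/-- A subset `K` of `W` is convex in the right Cayley graph: for all `x, y ∈ K`,
every geodesic from `x` to `y` has all of its vertices in `K`. -/
def IsConvex (cs : CoxeterSystem M W) (K : Set W) : Prop :=
  ∀ x ∈ K, ∀ y ∈ K, ∀ l : List B, x * cs.wordProd l = y →
    l.length = cs.length (x⁻¹ * y) →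
    ∀ n ≤ l.length, x * cs.wordProd (l.take n) ∈ K

/-- `ḋ_t := 1 − (1−q)/ȧ_t`. -/
noncomputable def dDot {cs : CoxeterSystem M W} {F : Type*} [Field F] {K : Set W}
    (P : AxiomBMap cs F K) (q : F) (t : W) : F :=
  1 - (1 - q) / P.ad t

open Polynomial in
/-- The alternating product of two reflections whose roots meet at the angle `π / m` is trivial. -/
theorem reflection_mul_reflection_pow_eq_one {V : Type*} [AddCommGroup V] [Module ℝ V]
    {x y : V} {f g : Module.Dual ℝ V} (hf : f x = 2) (hg : g y = 2) {m : ℕ} (hm : 2 ≤ m)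
    (hxy : g x = -2 * Real.cos (Real.pi / m)) (hyx : f y = -2 * Real.cos (Real.pi / m)) :
    (Module.reflection hf * Module.reflection hg) ^ m = 1 := by
  have hm0 : (m : ℝ) ≠ 0 := by positivity
  obtain rfl | hm3 := hm.eq_or_lt
  · have h1 : g x = 0 := by simp [hxy]
    have h2 : f y = 0 := by simp [hyx]
    ext v
    simp only [pow_two, LinearEquiv.mul_apply, Module.reflection_apply, map_sub, map_smul,
      hf, hg, h1, h2, LinearEquiv.coe_one, id]
    module
  set θ : ℝ := 2 * (Real.pi / m) with hθ
  have hsin : Real.sin θ ≠ 0 := by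
    have hπ := Real.pi_pos
    have h3 : (3 : ℝ) ≤ m := by exact_mod_cast hm3
    refine (Real.sin_pos_of_pos_of_lt_pi (by positivity) ?_).ne'
    rw [hθ, ← mul_div_assoc, div_lt_iff₀ (by positivity)]
    nlinarith
  have ht : 2 * Real.cos θ = f y * g x - 2 := by
    rw [hxy, hyx, hθ, Real.cos_two_mul]
    ring
  have hS (n : ℤ) : (Chebyshev.S ℝ n).eval (2 * Real.cos θ) = Real.sin ((n + 1) * θ) / Real.sin θ :=
    eq_div_of_mul_eq hsin (Chebyshev.S_two_mul_real_cos θ n)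
  ext v
  rw [Module.reflection_mul_reflection_pow_apply hf hg m v _ ht]
  obtain ⟨n, rfl | rfl⟩ := m.even_or_odd'
  · have e1 : ((2 * n : ℕ) - 2 : ℤ) / 2 = n - 1 := by lia
    have e2 : ((2 * n : ℕ) - 1 : ℤ) / 2 = n - 1 := by lia
    have e3 : (Chebyshev.S ℝ ((n : ℤ) - 1)).eval (2 * Real.cos θ) = 0 := by
      have hn : (n : ℝ) ≠ 0 := fun h ↦ hm0 (by simp [h])
      have : ((((n : ℤ) - 1 : ℤ) : ℝ) + 1) * θ = Real.pi := by
        rw [hθ]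
        push_cast
        field_simp
        ring
      rw [hS, this, Real.sin_pi, zero_div]
    rw [e1, e2, e3]
    simp
  · have e1 : ((2 * n + 1 : ℕ) - 2 : ℤ) / 2 = n - 1 := by lia
    have e2 : ((2 * n + 1 : ℕ) - 1 : ℤ) / 2 = n := by lia
    have e3 : ((2 * n + 1 : ℕ) - 3 : ℤ) / 2 = n - 1 := by lia
    have e4 : ((2 * n + 1 : ℕ) : ℤ) / 2 = n := by lia
    have e5 : (Chebyshev.S ℝ (n : ℤ)).eval (2 * Real.cos θ) +
        (Chebyshev.S ℝ ((n : ℤ) - 1)).eval (2 * Real.cos θ) = 0 := by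
      have : (((n : ℤ) : ℝ) + 1) * θ = 2 * Real.pi - (((n : ℤ) - 1 : ℤ) + 1 : ℝ) * θ := by
        push_cast at hm0 ⊢
        rw [hθ]
        push_cast
        field_simp
        ring
      rw [hS, hS, this, Real.sin_two_pi_sub]
      ring
    rw [e1, e2, e3, e4, e5]
    simp

namespace CoxeterSystem

variable (cs : CoxeterSystem M W)

/-- The linear form on the geometric representation that is dual to the simple root of `a`. -/
noncomputable def simpleCoroot (M : CoxeterMatrix B) (a : B) : Module.Dual ℝ (B →₀ ℝ) :=
  Finsupp.linearCombination ℝ fun b ↦ -2 * Real.cos (Real.pi / M a b)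

theorem simpleCoroot_single (M : CoxeterMatrix B) (a b : B) :
    simpleCoroot M a (Finsupp.single b 1) = -2 * Real.cos (Real.pi / M a b) := by
  simp [simpleCoroot]

theorem simpleCoroot_single_self (M : CoxeterMatrix B) (a : B) :
    simpleCoroot M a (Finsupp.single a 1) = 2 := by
  simp [simpleCoroot_single]

theorem isLiftable_reflection (M : CoxeterMatrix B) :
    M.IsLiftable fun a ↦ Module.reflection (simpleCoroot_single_self M a) := by
  intro a b
  obtain h | h | h : M a b = 0 ∨ M a b = 1 ∨ 2 ≤ M a b := by lia
  · simp [h]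
  · obtain rfl : a = b := by
      by_contra hab
      exact M.off_diagonal a b hab h
    ext1 v
    simp [LinearEquiv.mul_apply, (Module.involutive_reflection (simpleCoroot_single_self M a)) v]
  · refine reflection_mul_reflection_pow_eq_one _ _ h ?_ ?_
    · rw [simpleCoroot_single, M.symmetric b a]
    · rw [simpleCoroot_single]

theorem simple_injective : Function.Injective cs.simple := by
  intro a b hab
  by_contra hne
  have h := congrArg (cs.lift ⟨_, isLiftable_reflection M⟩) hab
  rw [cs.lift_apply_simple, cs.lift_apply_simple] at h
  have h' := congrArg (fun e : (B →₀ ℝ) ≃ₗ[ℝ] (B →₀ ℝ) ↦ e (Finsupp.single a 1) a) h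
  simp only [Module.reflection_apply_self, Module.reflection_apply] at h'
  simp [Ne.symm hne] at h'
  norm_num at h'

theorem end_mul_apply {X : Type*} (f g : Function.End X) (x : X) : (f * g) x = f (g x) := rfl

open scoped Classical in
/-- The permutation `(t, ε) ↦ (sts, ε + [t = s])` of `W × ℤ/2` attached to a simple reflection `s`. -/
noncomputable def signedConj (a : B) : Function.End (W × ZMod 2) := fun p ↦
  (cs.simple a * p.1 * cs.simple a, p.2 + if p.1 = cs.simple a then 1 else 0)

theorem pow_mul_simple_mul_pow (a b : B) (n : ℕ) :
    (cs.simple a * cs.simple b) ^ n * cs.simple b * (cs.simple a * cs.simple b) ^ n =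
      cs.simple b := by
  induction n with
  | zero => simp
  | succ n ih =>
    calc (cs.simple a * cs.simple b) ^ (n + 1) * cs.simple b *
          (cs.simple a * cs.simple b) ^ (n + 1) = (cs.simple a * cs.simple b) ^ n *
          (cs.simple a * (cs.simple b * cs.simple b) * cs.simple a) * cs.simple b *
          (cs.simple a * cs.simple b) ^ n := by
            nth_rw 1 [pow_succ]
            rw [pow_succ']
            simp only [mul_assoc]
      _ = _ := by simp [ih]

open scoped Classical in
theorem signedConj_mul_signedConj_pow (a b : B) (n : ℕ) (p : W × ZMod 2) :
    ((cs.signedConj a * cs.signedConj b) ^ n : Function.End (W × ZMod 2)) p =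
      ((cs.simple a * cs.simple b) ^ n * p.1 * ((cs.simple a * cs.simple b) ^ n)⁻¹,
        p.2 + ∑ k ∈ Finset.range (2 * n),
          if p.1 = cs.simple b * (cs.simple a * cs.simple b) ^ k then 1 else 0) := by
  induction n with
  | zero => simp [Function.End.one_def]
  | succ n ih =>
    have key := cs.pow_mul_simple_mul_pow a b n
    rw [pow_succ', end_mul_apply, ih, end_mul_apply]
    set r := cs.simple a * cs.simple b with hr
    have e1 : r ^ n * p.1 * (r ^ n)⁻¹ = cs.simple b ↔ p.1 = cs.simple b * r ^ (2 * n) := by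
      rw [mul_inv_eq_iff_eq_mul, ← mul_right_inj (r ^ n) (b := p.1), two_mul, pow_add]
      simp only [← mul_assoc, key]
    have e2 : cs.simple b * (r ^ n * p.1 * (r ^ n)⁻¹) * cs.simple b = cs.simple a ↔
        p.1 = cs.simple b * r ^ (2 * n + 1) := by
      have h1 : cs.simple b * (r ^ n * p.1 * (r ^ n)⁻¹) * cs.simple b = cs.simple a ↔
          r ^ n * p.1 * (r ^ n)⁻¹ = cs.simple b * r := by
        rw [← mul_left_inj (cs.simple b), ← mul_right_inj (cs.simple b)]
        simp [mul_assoc, hr]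
      rw [h1, mul_inv_eq_iff_eq_mul, ← mul_right_inj (r ^ n) (b := p.1),
        show 2 * n + 1 = n + (n + 1) by ring, pow_add]
      simp only [← mul_assoc, key, pow_succ']
    rw [show 2 * (n + 1) = 2 * n + 1 + 1 by ring, Finset.sum_range_succ, Finset.sum_range_succ]
    simp only [signedConj, e1, e2, pow_succ' r n]
    refine Prod.ext ?_ ?_
    · simp [hr, mul_assoc]
    · simp [add_assoc]

theorem isLiftable_signedConj : M.IsLiftable cs.signedConj := by
  classical
  intro a b
  funext p
  rw [signedConj_mul_signedConj_pow, two_mul, Finset.sum_range_add]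
  simp [pow_add, Function.End.one_def, CharTwo.add_self_eq_zero]

/-- The parity of the number of times `t` occurs in the right inversion sequence of a word
for `w`. -/
noncomputable def invParity (w t : W) : ZMod 2 :=
  (cs.lift ⟨_, cs.isLiftable_signedConj⟩ w (t, 0)).2

open scoped Classical in
theorem lift_signedConj_wordProd (ω : List B) (p : W × ZMod 2) :
    cs.lift ⟨_, cs.isLiftable_signedConj⟩ (cs.wordProd ω) p =
      (cs.wordProd ω * p.1 * (cs.wordProd ω)⁻¹, p.2 + (cs.rightInvSeq ω).count p.1) := by
  induction ω with
  | nil => simp [Function.End.one_def]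
  | cons a ω ih =>
    rw [wordProd_cons, map_mul, end_mul_apply, ih,
      cs.lift_apply_simple]
    have h : cs.wordProd ω * p.1 * (cs.wordProd ω)⁻¹ = cs.simple a ↔
        (cs.wordProd ω)⁻¹ * cs.simple a * cs.wordProd ω = p.1 := by
      rw [mul_inv_eq_iff_eq_mul, mul_assoc, inv_mul_eq_iff_eq_mul, eq_comm]
    simp only [signedConj, h, rightInvSeq, List.count_cons, beq_iff_eq]
    refine Prod.ext ?_ ?_
    · simp [mul_assoc]
    · simp [add_assoc]

theorem lift_signedConj_apply (w : W) (p : W × ZMod 2) :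
    cs.lift ⟨_, cs.isLiftable_signedConj⟩ w p = (w * p.1 * w⁻¹, p.2 + cs.invParity w p.1) := by
  obtain ⟨ω, rfl⟩ := cs.wordProd_surjective w
  simp [invParity, lift_signedConj_wordProd]

open scoped Classical in
theorem invParity_mul_simple (w t : W) (a : B) :
    cs.invParity (w * cs.simple a) t =
      (if t = cs.simple a then 1 else 0) +
        cs.invParity w (cs.simple a * t * cs.simple a) := by
  rw [invParity, map_mul, end_mul_apply, lift_signedConj_apply,
    cs.lift_apply_simple]
  simp [signedConj]

theorem length_mul_lt_of_invParity_ne_zero {w t : W} (h : cs.invParity w t ≠ 0) :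
    cs.length (w * t) < cs.length w := by
  classical
  obtain ⟨ω, hω, rfl⟩ := cs.exists_isReduced w
  refine (cs.isRightInversion_of_mem_rightInvSeq hω ?_).2
  rw [invParity, lift_signedConj_wordProd] at h
  by_contra hmem
  simp [List.count_eq_zero_of_not_mem hmem] at h

theorem length_lt_mul_simple_of_invParity_eq_zero {w : W} {a : B}
    (h : cs.invParity w (cs.simple a) = 0) : cs.length (w * cs.simple a) = cs.length w + 1 := by
  refine (cs.length_mul_simple w a).resolve_right fun hlt ↦ ?_
  have h0 : cs.invParity (w * cs.simple a) (cs.simple a) = 0 := by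
    by_contra hne
    have := cs.length_mul_lt_of_invParity_ne_zero hne
    rw [cs.simple_mul_simple_cancel_right] at this
    lia
  rw [invParity_mul_simple] at h0
  simp [h] at h0

theorem simple_mul_simple_mul_simple_eq {i j : B} (hm : M i j = 3) :
    cs.simple i * cs.simple j * cs.simple i = cs.simple j * cs.simple i * cs.simple j := by
  have h := cs.simple_mul_simple_pow i j
  rw [hm, pow_three] at h
  have h' : cs.simple i * cs.simple j * cs.simple i *
      (cs.simple j * cs.simple i * cs.simple j) = 1 := by simpa only [mul_assoc] using h
  simpa [mul_assoc] using mul_eq_one_iff_eq_inv.mp h'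

/-- Lengths in a coset of a parabolic subgroup of type `A₂`. -/
theorem length_of_not_descents {i j : B} (hm : M i j = 3) {w : W}
    (hi : cs.length w < cs.length (w * cs.simple i))
    (hj : cs.length w < cs.length (w * cs.simple j)) :
    cs.length (w * cs.simple i) = cs.length w + 1 ∧
      cs.length (w * cs.simple i * cs.simple j) = cs.length w + 2 ∧
      cs.length (w * cs.simple i * cs.simple j * cs.simple i) = cs.length w + 3 := by
  have hb := cs.simple_mul_simple_mul_simple_eq hm
  have hne : cs.simple i ≠ cs.simple j := fun h ↦ by
    have := cs.simple_injective h
    subst this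
    simp at hm
  have h1 : cs.length (w * cs.simple i) = cs.length w + 1 :=
    (cs.length_mul_simple w i).resolve_right (by lia)
  have hNj : cs.invParity w (cs.simple j) = 0 := by
    by_contra h
    exact (cs.length_mul_lt_of_invParity_ne_zero h).not_gt hj
  have hN1 : cs.invParity (w * cs.simple i) (cs.simple j) =
      cs.invParity w (cs.simple i * cs.simple j * cs.simple i) := by
    rw [invParity_mul_simple, if_neg hne.symm, zero_add]
  have hN2 : cs.invParity (w * cs.simple i * cs.simple j) (cs.simple i) = 0 := by
    rw [invParity_mul_simple, if_neg hne, zero_add, ← hb, invParity_mul_simple, if_neg, zero_add]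
    · simpa [mul_assoc] using hNj
    · intro h
      have : cs.simple i * cs.simple j = 1 := mul_eq_right.mp h
      exact hne (by rw [← cs.inv_simple j]; exact mul_eq_one_iff_eq_inv.mp this)
  have h3 := cs.length_lt_mul_simple_of_invParity_eq_zero hN2
  have h0 : cs.invParity w (cs.simple i * cs.simple j * cs.simple i) = 0 := by
    by_contra h
    have h4 := cs.length_mul_lt_of_invParity_ne_zero h
    simp only [← mul_assoc] at h4
    have h5 := cs.length_mul_simple (w * cs.simple i) j
    lia
  have h2 := cs.length_lt_mul_simple_of_invParity_eq_zero (hN1.trans h0)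
  lia

end CoxeterSystem

/-- Two endomorphisms `S`, `T` act along the edges of a hexagon of vectors `e₀, …, e₅`, where
`e₀` is joined to `e₁` and `e₂`, `e₁` to `e₃`, `e₂` to `e₄`, and `e₃`, `e₄` to `e₅`.
The coefficients on opposite edges agree, and on each edge the action satisfies the
quadratic relation with eigenvalues `1` and `-q`. -/
structure IsHeckeHexagon {F V : Type*} [Field F] [AddCommGroup V] [Module F V] (q : F)
    (S T : Module.End F V) (e₀ e₁ e₂ e₃ e₄ e₅ : V) (a₁ a₂ a₃ b₁ b₂ b₃ c₁ c₂ c₃ : F) : Prop where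
  S₀ : S e₀ = a₁ • e₀ + b₁ • e₁
  S₁ : S e₁ = (1 - q - a₁) • e₁ + c₁ • e₀
  S₂ : S e₂ = a₃ • e₂ + b₃ • e₄
  S₄ : S e₄ = (1 - q - a₃) • e₄ + c₃ • e₂
  S₃ : S e₃ = a₂ • e₃ + b₂ • e₅
  S₅ : S e₅ = (1 - q - a₂) • e₅ + c₂ • e₃
  T₀ : T e₀ = a₂ • e₀ + b₂ • e₂
  T₂ : T e₂ = (1 - q - a₂) • e₂ + c₂ • e₀
  T₁ : T e₁ = a₃ • e₁ + b₃ • e₃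
  T₃ : T e₃ = (1 - q - a₃) • e₃ + c₃ • e₁
  T₄ : T e₄ = a₁ • e₄ + b₁ • e₅
  T₅ : T e₅ = (1 - q - a₁) • e₅ + c₁ • e₄
  N₁ : b₁ * c₁ = (1 - a₁) * (a₁ + q)
  N₂ : b₂ * c₂ = (1 - a₂) * (a₂ + q)
  N₃ : b₃ * c₃ = (1 - a₃) * (a₃ + q)

namespace IsHeckeHexagon

variable {F V : Type*} [Field F] [AddCommGroup V] [Module F V] {q : F} {S T : Module.End F V}
  {e₀ e₁ e₂ e₃ e₄ e₅ : V} {a₁ a₂ a₃ b₁ b₂ b₃ c₁ c₂ c₃ : F}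

theorem symm (h : IsHeckeHexagon q S T e₀ e₁ e₂ e₃ e₄ e₅ a₁ a₂ a₃ b₁ b₂ b₃ c₁ c₂ c₃) :
    IsHeckeHexagon q T S e₀ e₂ e₁ e₄ e₃ e₅ a₂ a₁ a₃ b₂ b₁ b₃ c₂ c₁ c₃ :=
  ⟨h.T₀, h.T₂, h.T₁, h.T₃, h.T₄, h.T₅, h.S₀, h.S₁, h.S₂, h.S₄, h.S₃, h.S₅, h.N₂, h.N₁, h.N₃⟩

variable (h : IsHeckeHexagon q S T e₀ e₁ e₂ e₃ e₄ e₅ a₁ a₂ a₃ b₁ b₂ b₃ c₁ c₂ c₃)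

include h

theorem braid (R : a₁ * a₂ = a₃ * (a₁ + a₂ - (1 - q))) :
    S (T (S e₀)) = T (S (T e₀)) ∧ S (T (S e₁)) = T (S (T e₁)) ∧ S (T (S e₂)) = T (S (T e₂)) ∧
      S (T (S e₃)) = T (S (T e₃)) ∧ S (T (S e₄)) = T (S (T e₄)) ∧ S (T (S e₅)) = T (S (T e₅)) := by
  obtain ⟨S₀, S₁, S₂, S₄, S₃, S₅, T₀, T₂, T₁, T₃, T₄, T₅, N₁, N₂, N₃⟩ := h
  refine ⟨?_, ?_, ?_, ?_, ?_, ?_⟩ <;>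
  · simp only [map_add, map_smul, S₀, S₁, S₂, S₃, S₄, S₅, T₀, T₁, T₂, T₃, T₄, T₅]
    match_scalars <;> grind

theorem coeff_relation (φ : Module.Dual F V) (h₀ : φ e₀ = 0) (h₁ : φ e₁ = 1) (h₂ : φ e₂ = 0)
    (h₃ : φ e₃ = 0) (h₄ : φ e₄ = 0) (h₅ : φ e₅ = 0) (hb : b₁ ≠ 0)
    (hbraid : S (T (S e₀)) = T (S (T e₀))) : a₁ * a₂ = a₃ * (a₁ + a₂ - (1 - q)) := by
  obtain ⟨S₀, S₁, S₂, -, S₃, -, T₀, T₂, T₁, -, T₄, -, -, -, -⟩ := h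
  have key := congrArg φ hbraid
  simp only [map_add, map_smul, S₀, S₁, S₂, S₃, T₀, T₁, T₂, T₄, h₀, h₁, h₂, h₃, h₄, h₅,
    smul_eq_mul] at key
  refine mul_left_cancel₀ hb ?_
  linear_combination key

end IsHeckeHexagon

/-- A convex set containing the identity is closed under passing to right weak order covers
from above. -/
theorem IsConvex.mem_of_lt {cs : CoxeterSystem M W} {K : Set W} (hK : IsConvex cs K)
    (h1 : (1 : W) ∈ K) {w : W} {a : B} (hw : w * cs.simple a ∈ K)
    (hlt : cs.length w < cs.length (w * cs.simple a)) : w ∈ K := by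
  obtain ⟨ω, hω, rfl⟩ := cs.exists_isReduced w
  have hlen : cs.length (cs.wordProd ω * cs.simple a) = ω.length + 1 := by
    have := cs.length_mul_simple (cs.wordProd ω) a
    have := hω.eq
    lia
  have := hK 1 h1 _ hw (ω ++ [a]) (by simp [cs.wordProd_append]) (by simp [hlen]) ω.length (by simp)
  simpa using this

open scoped Classical in
/-- The basis vector `C_w` if `w ∈ K`, and zero otherwise. -/
noncomputable def extCvec {X : Type*} (F : Type*) [Field F] (K : Set X) (w : X) : ↥K →₀ F :=
  if h : w ∈ K then Cvec F K w h else 0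

theorem extCvec_of_mem {X : Type*} (F : Type*) [Field F] {K : Set X} {w : X} (h : w ∈ K) :
    extCvec F K w = Cvec F K w h := dif_pos h

theorem extCvec_of_notMem {X : Type*} (F : Type*) [Field F] {K : Set X} {w : X} (h : w ∉ K) :
    extCvec F K w = 0 := dif_neg h

theorem extCvec_apply_self {X : Type*} (F : Type*) [Field F] {K : Set X} (x : K) :
    extCvec F K x x = 1 := by
  simp [extCvec_of_mem F x.2, Cvec]

theorem extCvec_apply_of_ne {X : Type*} (F : Type*) [Field F] {K : Set X} {w : X} {x : K}
    (h : w ≠ x) :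
    extCvec F K w x = 0 := by
  classical
  by_cases hw : w ∈ K
  · rw [extCvec_of_mem F hw, Cvec, Finsupp.single_apply, if_neg]
    exact fun h' ↦ h (congrArg Subtype.val h')
  · simp [extCvec_of_notMem F hw]

namespace AxiomBMap

variable {cs : CoxeterSystem M W} {F : Type*} [Field F] {K : Set W} (P : AxiomBMap cs F K)
  {q : F}

open scoped Classical in
/-- The coefficient `b̈`, set to zero on the reflections with `ḃ = 0`. -/
noncomputable def downCoeff (t : W) : F := if P.bd t = 0 then 0 else P.bBar t

variable (hHecke : ∀ i : B, (P.ρ i - 1) * (P.ρ i + q • 1) = 0)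

include hHecke in
theorem hecke_apply (i : B) (v : ↥K →₀ F) : P.ρ i (P.ρ i v) = (1 - q) • P.ρ i v + q • v := by
  have h := LinearMap.congr_fun (hHecke i) v
  simp only [Module.End.mul_apply, LinearMap.sub_apply, LinearMap.add_apply, LinearMap.smul_apply,
    Module.End.one_apply, map_add, map_smul, LinearMap.zero_apply] at h
  rw [← sub_eq_zero, ← h]
  module

theorem mem_TK {i : B} {x : W} (hx : x ∈ K) (hxs : x * cs.simple i ∈ K) :
    x * cs.simple i * x⁻¹ ∈ TK cs K := ⟨i, x, hx, hxs, rfl⟩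

include hHecke in
theorem hecke_coeff {i : B} {x : W} (hx : x ∈ K) (hxs : x * cs.simple i ∈ K)
    (hlt : cs.length x < cs.length (x * cs.simple i))
    (hb : P.bd (x * cs.simple i * x⁻¹) ≠ 0) :
    P.aBar (x * cs.simple i * x⁻¹) = 1 - q - P.ad (x * cs.simple i * x⁻¹) ∧
      P.bd (x * cs.simple i * x⁻¹) * P.bBar (x * cs.simple i * x⁻¹) =
        (1 - P.ad (x * cs.simple i * x⁻¹)) * (P.ad (x * cs.simple i * x⁻¹) + q) := by
  have hup := P.axiomB_lt_mem i x hx hxs hlt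
  have hdown := P.axiomB_gt_mem i (x * cs.simple i) hxs (by simpa using hx) (by simpa using hlt)
  have ht : x * cs.simple i * cs.simple i * (x * cs.simple i)⁻¹ = x * cs.simple i * x⁻¹ := by
    simp [mul_assoc]
  rw [ht] at hdown
  set t := x * cs.simple i * x⁻¹
  have h := P.hecke_apply hHecke i (Cvec F K x hx)
  have hne : x ≠ x * cs.simple i := fun h ↦ by rw [← h] at hlt; exact lt_irrefl _ hlt
  rw [hup, map_add, map_smul, map_smul, hup, hdown] at h
  have hx1 := DFunLike.congr_fun h ⟨x, hx⟩
  have hx2 := DFunLike.congr_fun h ⟨x * cs.simple i, hxs⟩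
  simp [Cvec, hne, hne.symm] at hx1 hx2
  constructor
  · refine mul_left_cancel₀ hb ?_
    linear_combination hx2
  · linear_combination hx1

include hHecke in
theorem ad_boundary {i : B} {x : W} (hx : x ∈ K) (hxs : x * cs.simple i ∉ K)
    (hlt : cs.length x < cs.length (x * cs.simple i)) :
    (1 - P.ad (x * cs.simple i * x⁻¹)) * (P.ad (x * cs.simple i * x⁻¹) + q) = 0 := by
  have hup := P.axiomB_lt_not_mem i x hx hxs hlt
  have h := P.hecke_apply hHecke i (Cvec F K x hx)
  rw [hup, map_smul, hup] at h
  have hx1 := DFunLike.congr_fun h ⟨x, hx⟩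
  simp [Cvec] at hx1
  linear_combination -hx1

include hHecke in
theorem bd_mul_downCoeff (hbd : ∀ t ∈ TK cs K, P.bd t ≠ 0) {i : B} {x : W} (hx : x ∈ K)
    (hlt : cs.length x < cs.length (x * cs.simple i)) :
    P.bd (x * cs.simple i * x⁻¹) * P.downCoeff (x * cs.simple i * x⁻¹) =
      (1 - P.ad (x * cs.simple i * x⁻¹)) * (P.ad (x * cs.simple i * x⁻¹) + q) := by
  by_cases hxs : x * cs.simple i ∈ K
  · have hb := hbd _ (mem_TK hx hxs)
    rw [downCoeff, if_neg hb, (P.hecke_coeff hHecke hx hxs hlt hb).2]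
  · rw [P.bd_eq_zero i x hx hxs hlt, zero_mul, P.ad_boundary hHecke hx hxs hlt]

include hHecke in
theorem ad_ne_zero (hq0 : q ≠ 0) (had : ∀ t ∈ TK cs K, P.ad t ≠ 0) {i : B} {x : W} (hx : x ∈ K)
    (hlt : cs.length x < cs.length (x * cs.simple i)) : P.ad (x * cs.simple i * x⁻¹) ≠ 0 := by
  by_cases hxs : x * cs.simple i ∈ K
  · exact had _ (mem_TK hx hxs)
  · intro h0
    have := P.ad_boundary hHecke hx hxs hlt
    simp [h0, hq0] at this

variable (hKconv : IsConvex cs K) (h1K : (1 : W) ∈ K) (hbd : ∀ t ∈ TK cs K, P.bd t ≠ 0)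

include hKconv h1K in
theorem apply_up {i : B} {x y t : W} (hy : x * cs.simple i = y) (ht : x * cs.simple i * x⁻¹ = t)
    (hlt : cs.length x < cs.length y) :
    P.ρ i (extCvec F K x) = P.ad t • extCvec F K x + P.bd t • extCvec F K y := by
  subst hy ht
  by_cases hx : x ∈ K
  · by_cases hxs : x * cs.simple i ∈ K
    · rw [extCvec_of_mem F hx, extCvec_of_mem F hxs, P.axiomB_lt_mem i x hx hxs hlt]
    · rw [extCvec_of_mem F hx, extCvec_of_notMem F hxs, P.axiomB_lt_not_mem i x hx hxs hlt,
        smul_zero, add_zero]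
  · have hxs : x * cs.simple i ∉ K := fun h ↦ hx (hKconv.mem_of_lt h1K h hlt)
    simp [extCvec_of_notMem F hx, extCvec_of_notMem F hxs]

include hHecke hKconv h1K hbd in
theorem apply_down {i : B} {x y t : W} (hy : x * cs.simple i = y) (ht : x * cs.simple i * x⁻¹ = t)
    (hlt : cs.length x < cs.length y) :
    P.ρ i (extCvec F K y) =
      (1 - q - P.ad t) • extCvec F K y + P.downCoeff t • extCvec F K x := by
  subst hy ht
  by_cases hxs : x * cs.simple i ∈ K
  · have hx : x ∈ K := hKconv.mem_of_lt h1K hxs hlt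
    have hb := hbd _ (mem_TK hx hxs)
    have h := P.axiomB_gt_mem i (x * cs.simple i) hxs (by simpa using hx) (by simpa using hlt)
    have ht : x * cs.simple i * cs.simple i * (x * cs.simple i)⁻¹ = x * cs.simple i * x⁻¹ := by
      simp [mul_assoc]
    rw [ht, (P.hecke_coeff hHecke hx hxs hlt hb).1] at h
    rw [downCoeff, if_neg hb, extCvec_of_mem F hx, extCvec_of_mem F hxs, h]
    simp
  · by_cases hx : x ∈ K
    · have hb := P.bd_eq_zero i x hx hxs hlt
      simp [downCoeff, hb, extCvec_of_notMem F hxs]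
    · simp [extCvec_of_notMem F hx, extCvec_of_notMem F hxs]

include hHecke hKconv h1K hbd in
theorem isHeckeHexagon {i j : B} (hm : M i j = 3) {w : W} (hw : w ∈ K)
    (hi : cs.length w < cs.length (w * cs.simple i))
    (hj : cs.length w < cs.length (w * cs.simple j))
    (hK : w * cs.simple i ∈ K ∨ w * cs.simple j ∈ K) :
    IsHeckeHexagon q (P.ρ i) (P.ρ j) (extCvec F K w) (extCvec F K (w * cs.simple i))
      (extCvec F K (w * cs.simple j)) (extCvec F K (w * cs.simple i * cs.simple j))
      (extCvec F K (w * cs.simple j * cs.simple i))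
      (extCvec F K (w * cs.simple i * cs.simple j * cs.simple i))
      (P.ad (w * cs.simple i * w⁻¹)) (P.ad (w * cs.simple j * w⁻¹))
      (P.ad (w * cs.simple i * cs.simple j * cs.simple i * w⁻¹))
      (P.bd (w * cs.simple i * w⁻¹)) (P.bd (w * cs.simple j * w⁻¹))
      (P.bd (w * cs.simple i * cs.simple j * cs.simple i * w⁻¹))
      (P.downCoeff (w * cs.simple i * w⁻¹)) (P.downCoeff (w * cs.simple j * w⁻¹))
      (P.downCoeff (w * cs.simple i * cs.simple j * cs.simple i * w⁻¹)) := by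
  have hb := cs.simple_mul_simple_mul_simple_eq hm
  have hbw (v : W) : v * cs.simple i * cs.simple j * cs.simple i =
      v * cs.simple j * cs.simple i * cs.simple j := by
    simpa only [mul_assoc] using congrArg (v * ·) hb
  obtain ⟨li, lij, liji⟩ := cs.length_of_not_descents hm hi hj
  obtain ⟨lj, lji, ljij⟩ := cs.length_of_not_descents ((M.symmetric j i).trans hm) hj hi
  have t₃ : w * cs.simple i * cs.simple j * (w * cs.simple i)⁻¹ =
      w * cs.simple i * cs.simple j * cs.simple i * w⁻¹ := by simp [mul_assoc]
  have t₃' : w * cs.simple j * cs.simple i * (w * cs.simple j)⁻¹ =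
      w * cs.simple i * cs.simple j * cs.simple i * w⁻¹ := by rw [hbw]; simp [mul_assoc]
  have t₂ : w * cs.simple i * cs.simple j * cs.simple i * (w * cs.simple i * cs.simple j)⁻¹ =
      w * cs.simple j * w⁻¹ := by rw [hbw]; simp [mul_assoc]
  have t₁ : w * cs.simple j * cs.simple i * cs.simple j * (w * cs.simple j * cs.simple i)⁻¹ =
      w * cs.simple i * w⁻¹ := by rw [← hbw]; simp [mul_assoc]
  have up := fun {i : B} {x y t : W} ↦ P.apply_up hKconv h1K (i := i) (x := x) (y := y) (t := t)
  have down := fun {i : B} {x y t : W} ↦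
    P.apply_down hHecke hKconv h1K hbd (i := i) (x := x) (y := y) (t := t)
  refine ⟨up rfl rfl hi, down rfl rfl hi, up rfl t₃' (by lia), down rfl t₃' (by lia),
    up rfl t₂ (by lia), down rfl t₂ (by lia), up rfl rfl hj, down rfl rfl hj,
    up rfl t₃ (by lia), down rfl t₃ (by lia), up (hbw w).symm t₁ (by lia),
    down (hbw w).symm t₁ (by lia), P.bd_mul_downCoeff hHecke hbd hw hi,
    P.bd_mul_downCoeff hHecke hbd hw hj, ?_⟩
  obtain h | h := hK
  · simpa only [t₃] using P.bd_mul_downCoeff hHecke hbd (i := j) h (by lia)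
  · simpa only [t₃'] using P.bd_mul_downCoeff hHecke hbd (i := i) h (by lia)

end AxiomBMap

theorem dDot_eq_dDot_iff {cs : CoxeterSystem M W} {F : Type*} [Field F] {K : Set W}
    {P : AxiomBMap cs F K} {q : F} (hq1 : q ≠ 1) {s t : W} (hs : P.ad s ≠ 0) (ht : P.ad t ≠ 0) :
    dDot P q s = dDot P q t ↔ P.ad s = P.ad t := by
  refine ⟨fun h ↦ ?_, fun h ↦ by rw [dDot, dDot, h]⟩
  have hq : 1 - q ≠ 0 := sub_ne_zero.mpr hq1.symm
  rw [dDot, dDot, sub_right_inj, div_eq_div_iff hs ht] at h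
  exact (mul_left_cancel₀ hq h).symm

theorem dDot_eq_mul_iff {cs : CoxeterSystem M W} {F : Type*} [Field F] {K : Set W}
    {P : AxiomBMap cs F K} {q : F} (hq1 : q ≠ 1) {r s t : W} (hr : P.ad r ≠ 0) (hs : P.ad s ≠ 0)
    (ht : P.ad t ≠ 0) :
    dDot P q r = dDot P q s * dDot P q t ↔
      P.ad s * P.ad t = P.ad r * (P.ad s + P.ad t - (1 - q)) := by
  have hq : 1 - q ≠ 0 := sub_ne_zero.mpr hq1.symm
  simp only [dDot]
  field_simp
  refine ⟨fun h ↦ mul_left_cancel₀ hq ?_, fun h ↦ ?_⟩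
  · linear_combination -h
  · linear_combination (q - 1) * h

theorem dDot_eq_or_eq_inv {cs : CoxeterSystem M W} {F : Type*} [Field F] {K : Set W}
    {P : AxiomBMap cs F K} {q : F} (hq0 : q ≠ 0) {t : W}
    (h : (1 - P.ad t) * (P.ad t + q) = 0) : dDot P q t = q ∨ dDot P q t = q⁻¹ := by
  rcases mul_eq_zero.mp h with h | h
  · left
    rw [dDot, ← sub_eq_zero.mp h]
    ring
  · right
    rw [dDot, eq_neg_of_add_eq_zero_left h]
    field_simp
    ring

/-- Every element of a convex set containing the identity lies in the hexagon above an element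
of the set without right descents in `{i, j}`. -/
theorem IsConvex.exists_not_descents {cs : CoxeterSystem M W} {K : Set W} (hK : IsConvex cs K)
    (h1 : (1 : W) ∈ K) {i j : B} (hm : M i j = 3) {x : W} (hx : x ∈ K) :
    ∃ w ∈ K, cs.length w < cs.length (w * cs.simple i) ∧
      cs.length w < cs.length (w * cs.simple j) ∧
      (x = w ∨ x = w * cs.simple i ∨ x = w * cs.simple j ∨ x = w * cs.simple i * cs.simple j ∨
        x = w * cs.simple j * cs.simple i ∨ x = w * cs.simple i * cs.simple j * cs.simple i) := by
  have hb (v : W) : v * cs.simple i * cs.simple j * cs.simple i =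
      v * cs.simple j * cs.simple i * cs.simple j := by
    simpa only [mul_assoc] using congrArg (v * ·) (cs.simple_mul_simple_mul_simple_eq hm)
  induction hn : cs.length x using Nat.strong_induction_on generalizing x with
  | _ n ih =>
    have step {a : B} (ha : ¬ cs.length x < cs.length (x * cs.simple a)) :
        cs.length (x * cs.simple a) < n ∧ x * cs.simple a ∈ K := by
      have hlt : cs.length (x * cs.simple a) < cs.length x := by
        have := cs.length_mul_simple x a
        lia
      exact ⟨hn ▸ hlt, hK.mem_of_lt h1 (a := a) (by simpa using hx) (by simpa using hlt)⟩
    by_cases hi : cs.length x < cs.length (x * cs.simple i)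
    · by_cases hj : cs.length x < cs.length (x * cs.simple j)
      · exact ⟨x, hx, hi, hj, Or.inl rfl⟩
      · obtain ⟨w, hw, hwi, hwj, h⟩ := ih _ (step hj).1 (step hj).2 rfl
        refine ⟨w, hw, hwi, hwj, ?_⟩
        rw [← cs.simple_mul_simple_cancel_right (w := x) j]
        rcases h with h | h | h | h | h | h <;> rw [h]
        · simp
        · simp
        · simp
        · simp
        · simp [← hb]
        · simp [hb]
    · obtain ⟨w, hw, hwi, hwj, h⟩ := ih _ (step hi).1 (step hi).2 rfl
      refine ⟨w, hw, hwi, hwj, ?_⟩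
      rw [← cs.simple_mul_simple_cancel_right (w := x) i]
      rcases h with h | h | h | h | h | h <;> rw [h] <;> simp

namespace AxiomBMap

variable {cs : CoxeterSystem M W} {F : Type*} [Field F] {K : Set W} (P : AxiomBMap cs F K)
  {q : F} (hHecke : ∀ i : B, (P.ρ i - 1) * (P.ρ i + q • 1) = 0)
  {i j : B} (hm : M i j = 3) {w : W} (hw : w ∈ K)
  (hi : cs.length w < cs.length (w * cs.simple i))
  (hj : cs.length w < cs.length (w * cs.simple j))

include hHecke hm hi hj in
theorem ad_top_ne_zero (hq0 : q ≠ 0) (had : ∀ t ∈ TK cs K, P.ad t ≠ 0)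
    (hK : w * cs.simple i ∈ K ∨ w * cs.simple j ∈ K) :
    P.ad (w * cs.simple i * cs.simple j * cs.simple i * w⁻¹) ≠ 0 := by
  have hb : w * cs.simple i * cs.simple j * cs.simple i =
      w * cs.simple j * cs.simple i * cs.simple j := by
    simpa only [mul_assoc] using congrArg (w * ·) (cs.simple_mul_simple_mul_simple_eq hm)
  obtain ⟨li, lij, -⟩ := cs.length_of_not_descents hm hi hj
  obtain ⟨lj, lji, -⟩ := cs.length_of_not_descents ((M.symmetric j i).trans hm) hj hi
  obtain h | h := hK
  · convert P.ad_ne_zero hHecke hq0 had (i := j) h (by lia) using 2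
    simp [mul_assoc]
  · convert P.ad_ne_zero hHecke hq0 had (i := i) h (by lia) using 2
    rw [hb]
    simp [mul_assoc]

include hHecke hm hi hj hw in
theorem coeff_relation_of_mem (hKconv : IsConvex cs K) (h1K : (1 : W) ∈ K)
    (hbd : ∀ t ∈ TK cs K, P.bd t ≠ 0) (hiK : w * cs.simple i ∈ K)
    (hbraid : P.ρ i * P.ρ j * P.ρ i = P.ρ j * P.ρ i * P.ρ j) :
    P.ad (w * cs.simple i * w⁻¹) * P.ad (w * cs.simple j * w⁻¹) =
      P.ad (w * cs.simple i * cs.simple j * cs.simple i * w⁻¹) *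
        (P.ad (w * cs.simple i * w⁻¹) + P.ad (w * cs.simple j * w⁻¹) - (1 - q)) := by
  obtain ⟨li, lij, liji⟩ := cs.length_of_not_descents hm hi hj
  obtain ⟨lj, lji, ljij⟩ := cs.length_of_not_descents ((M.symmetric j i).trans hm) hj hi
  have hne : w * cs.simple j ≠ w * cs.simple i := fun h ↦ by
    obtain rfl := cs.simple_injective (mul_left_cancel h)
    simp at hm
  have hlen {y : W} (h : cs.length y ≠ cs.length w + 1) :
      extCvec F K y ⟨w * cs.simple i, hiK⟩ = 0 :=
    extCvec_apply_of_ne F (by rintro rfl; exact h li)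
  have H := P.isHeckeHexagon hHecke hKconv h1K hbd hm hw hi hj (Or.inl hiK)
  exact H.coeff_relation (Finsupp.lapply ⟨w * cs.simple i, hiK⟩) (hlen (by lia))
    (extCvec_apply_self F ⟨_, hiK⟩) (extCvec_apply_of_ne F hne) (hlen (by lia)) (hlen (by lia))
    (hlen (by lia)) (hbd _ (mem_TK hw hiK))
    (by simpa using LinearMap.congr_fun hbraid (extCvec F K w))

include hHecke hm hi hj hw in
theorem coeff_relation (hKconv : IsConvex cs K) (h1K : (1 : W) ∈ K)
    (hbd : ∀ t ∈ TK cs K, P.bd t ≠ 0) (hK : w * cs.simple i ∈ K ∨ w * cs.simple j ∈ K)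
    (hbraid : P.ρ i * P.ρ j * P.ρ i = P.ρ j * P.ρ i * P.ρ j) :
    P.ad (w * cs.simple i * w⁻¹) * P.ad (w * cs.simple j * w⁻¹) =
      P.ad (w * cs.simple i * cs.simple j * cs.simple i * w⁻¹) *
        (P.ad (w * cs.simple i * w⁻¹) + P.ad (w * cs.simple j * w⁻¹) - (1 - q)) := by
  obtain h | h := hK
  · exact P.coeff_relation_of_mem hHecke hm hw hi hj hKconv h1K hbd h hbraid
  · have hb : w * cs.simple i * cs.simple j * cs.simple i =
        w * cs.simple j * cs.simple i * cs.simple j := by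
      simpa only [mul_assoc] using congrArg (w * ·) (cs.simple_mul_simple_mul_simple_eq hm)
    have := P.coeff_relation_of_mem hHecke ((M.symmetric j i).trans hm) hw hj hi hKconv h1K hbd h
      hbraid.symm
    rw [hb]
    linear_combination this

end AxiomBMap

/-- Hecke-algebra analogue of STATEMENT 11: for a convex `K` containing the
identity, a map satisfying Axiom (B) and the Hecke relations `(ρ_s − 1)(ρ_s + q) = 0`,
with the stated nonvanishing, and `m(s,t) = 3`, the braid relation holds iff conditions
(a) and (b) hold, phrased in terms of `ḋ_t = 1 − (1−q)/ȧ_t`. -/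
theorem stmt12 (cs : CoxeterSystem M W) (F : Type*) [Field F] (K : Set W)
    (q : F) (hq0 : q ≠ 0) (hq1 : q ≠ 1)
    (hKconv : IsConvex cs K) (h1K : (1 : W) ∈ K)
    (P : AxiomBMap cs F K)
    (hHecke : ∀ i : B, (P.ρ i - 1) * (P.ρ i + q • 1) = 0)
    (had : ∀ t ∈ TK cs K, P.ad t ≠ 0)
    (hbd : ∀ t ∈ TK cs K, P.bd t ≠ 0) (hbBar : ∀ t ∈ TK cs K, P.bBar t ≠ 0)
    (i j : B) (hm : M i j = 3) :
    P.ρ i * P.ρ j * P.ρ i = P.ρ j * P.ρ i * P.ρ j ↔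
    ((∀ w ∈ K, cs.length w < cs.length (w * cs.simple i) →
        cs.length w < cs.length (w * cs.simple j) →
        (w * cs.simple i ∈ K ∨ w * cs.simple j ∈ K) →
        dDot P q (w * cs.simple i * cs.simple j * cs.simple i * w⁻¹) =
          dDot P q (w * cs.simple i * w⁻¹) * dDot P q (w * cs.simple j * w⁻¹)) ∧
      (∀ w ∈ K, w * cs.simple i ∉ K → w * cs.simple j ∉ K →
        dDot P q (w * cs.simple i * w⁻¹) = dDot P q (w * cs.simple j * w⁻¹) ∧
        (dDot P q (w * cs.simple i * w⁻¹) = q ∨ dDot P q (w * cs.simple i * w⁻¹) = q⁻¹))) := by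
  have lt_of_notMem {w : W} {a : B} (hw : w ∈ K) (h : w * cs.simple a ∉ K) :
      cs.length w < cs.length (w * cs.simple a) := by
    by_contra hlt
    refine h (hKconv.mem_of_lt h1K (a := a) (by simpa using hw) ?_)
    have := cs.length_mul_simple w a
    simp only [cs.simple_mul_simple_cancel_right]
    lia
  constructor
  · refine fun hbraid ↦ ⟨fun w hw hi hj hK ↦ ?_, fun w hw hiK hjK ↦ ?_⟩
    · rw [dDot_eq_mul_iff hq1 (P.ad_top_ne_zero hHecke hm hi hj hq0 had hK)
        (P.ad_ne_zero hHecke hq0 had hw hi) (P.ad_ne_zero hHecke hq0 had hw hj)]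
      exact P.coeff_relation hHecke hm hw hi hj hKconv h1K hbd hK hbraid
    · have hi := lt_of_notMem hw hiK
      have hj := lt_of_notMem hw hjK
      have hi0 := P.ad_ne_zero hHecke hq0 had hw hi
      have hj0 := P.ad_ne_zero hHecke hq0 had hw hj
      refine ⟨?_, dDot_eq_or_eq_inv hq0 (P.ad_boundary hHecke hw hiK hi)⟩
      rw [dDot_eq_dDot_iff hq1 hi0 hj0]
      have h := DFunLike.congr_fun (LinearMap.congr_fun hbraid (Cvec F K w hw)) ⟨w, hw⟩
      simp only [Module.End.mul_apply, map_smul, P.axiomB_lt_not_mem i w hw hiK hi,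
        P.axiomB_lt_not_mem j w hw hjK hj] at h
      simp only [Cvec, Finsupp.smul_apply, Finsupp.single_eq_same, smul_eq_mul, mul_one] at h
      refine mul_left_cancel₀ (mul_ne_zero hi0 hj0) ?_
      linear_combination h
  · rintro ⟨ha, hb⟩
    refine Finsupp.lhom_ext' fun x ↦ LinearMap.ext_ring ?_
    suffices h : P.ρ i (P.ρ j (P.ρ i (extCvec F K x))) =
        P.ρ j (P.ρ i (P.ρ j (extCvec F K x))) by
      simpa [extCvec_of_mem F x.2, Cvec] using h
    obtain ⟨w, hw, hi, hj, hx⟩ := hKconv.exists_not_descents h1K hm x.2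
    by_cases hK : w * cs.simple i ∈ K ∨ w * cs.simple j ∈ K
    · have hR := (dDot_eq_mul_iff hq1 (P.ad_top_ne_zero hHecke hm hi hj hq0 had hK)
        (P.ad_ne_zero hHecke hq0 had hw hi) (P.ad_ne_zero hHecke hq0 had hw hj)).mp
        (ha w hw hi hj hK)
      obtain ⟨E₀, E₁, E₂, E₃, E₄, E₅⟩ :=
        (P.isHeckeHexagon hHecke hKconv h1K hbd hm hw hi hj hK).braid hR
      rcases hx with hx | hx | hx | hx | hx | hx <;> rw [hx] <;> assumption
    · obtain ⟨hiK, hjK⟩ := not_or.mp hK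
      obtain ⟨li, lij, liji⟩ := cs.length_of_not_descents hm hi hj
      obtain ⟨lj, lji, ljij⟩ := cs.length_of_not_descents ((M.symmetric j i).trans hm) hj hi
      have hijK : w * cs.simple i * cs.simple j ∉ K := fun h ↦
        hiK (hKconv.mem_of_lt h1K h (by lia))
      have hjiK : w * cs.simple j * cs.simple i ∉ K := fun h ↦
        hjK (hKconv.mem_of_lt h1K h (by lia))
      have hijiK : w * cs.simple i * cs.simple j * cs.simple i ∉ K := fun h ↦
        hijK (hKconv.mem_of_lt h1K h (by lia))
      have hxK := x.2
      obtain hx | hx | hx | hx | hx | hx := hx <;> rw [hx] at hxK <;> try contradiction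
      have h := (dDot_eq_dDot_iff hq1 (P.ad_ne_zero hHecke hq0 had hw hi)
        (P.ad_ne_zero hHecke hq0 had hw hj)).mp (hb w hw hiK hjK).1
      simp only [hx, extCvec_of_mem F hw, map_smul, P.axiomB_lt_not_mem i w hw hiK hi,
        P.axiomB_lt_not_mem j w hw hjK hj, h]
end

section
/- Let (W,S) be an irreducible simply laced Coxeter system, let K be a convex subset of W containing the identity element, and let f ∈ V be K-generic. Define ȧ_t := 1/⟨f,α_t⟩ for t ∈ T_K ∪ T_∂K and ä_t := −ȧ_t for t ∈ T_K. Then for any choice of scalars ḃ_t, b̈_t ∈ ℝ (t ∈ T_K) satisfying ḃ_t·b̈_t = 1 − ȧ_t², there exists a representation ρ of W on the real vector space V_K such that for all s ∈ S and w ∈ K: ρ_s(C_w) = ȧ_{wsw⁻¹}·C_w + ḃ_{wsw⁻¹}·C_{ws} if ℓ(w) < ℓ(ws) and ws ∈ K; ρ_s(C_w) = ȧ_{wsw⁻¹}·C_w if ℓ(w) < ℓ(ws) and ws ∉ K; and ρ_s(C_w) = ä_{wsw⁻¹}·C_w + b̈_{wsw⁻¹}·C_{ws} if ℓ(w) > ℓ(ws)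 (in which case ws ∈ K). Moreover (ρ,K) is a minimal AY pair. -/
open CoxeterSystem

variable {B W : Type*} [Group W] {M : CoxeterMatrix B}

/-- `(W,S)` is simply laced: `m(s,t) ≤ 3` for all `s,t ∈ S` (and `m(s,t) ≠ ∞`). -/
def SimplyLaced (M : CoxeterMatrix B) : Prop :=
  ∀ i j : B, i ≠ j → M i j = 2 ∨ M i j = 3

/-- `(W,S)` is irreducible: the Coxeter graph is connected. -/
def IrreducibleCox (M : CoxeterMatrix B) : Prop :=
  ∀ i j : B, Relation.ReflTransGen (fun a b => M a b = 3) i j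

/-- The canonical bilinear form `B(α_i, α_j) = −cos(π / m(i,j))` on the root space
`V = B → ℝ`, extended bilinearly.  (Here `m(i,j) = 0` encodes `m(i,j) = ∞`, and division
by zero yields `−cos 0 = −1`, as required.) -/
noncomputable def bform (M : CoxeterMatrix B) [Fintype B] (u v : B → ℝ) : ℝ :=
  ∑ i, ∑ j, u i * v j * (-(Real.cos (Real.pi / (M i j : ℝ))))

/-- `f` is `K`-generic (with respect to the positive definite form `ip` and the system of
positive roots `αT`):
(i) `⟨f, α_t⟩ ∉ {0, 1, −1}` for `t ∈ T_K`;
(ii) `⟨f, α_t⟩ ∈ {1, −1}` for `t ∈ T_∂K`;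
(iii) if `w ∈ K`, `m(s,t) = 3` and `ws, wt ∉ K` then `⟨f, α_{wsw⁻¹}⟩ = ⟨f, α_{wtw⁻¹}⟩`. -/
def KGeneric (cs : CoxeterSystem M W) (K : Set W)
    (ip : (B → ℝ) →ₗ[ℝ] (B → ℝ) →ₗ[ℝ] ℝ) (αT : W → (B → ℝ)) (f : B → ℝ) : Prop :=
  (∀ t ∈ TK cs K, ip f (αT t) ≠ 0 ∧ ip f (αT t) ≠ 1 ∧ ip f (αT t) ≠ -1) ∧
  (∀ t ∈ TbK cs K, ip f (αT t) = 1 ∨ ip f (αT t) = -1) ∧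
  (∀ w ∈ K, ∀ i j : B, M i j = 3 → w * cs.simple i ∉ K → w * cs.simple j ∉ K →
    ip f (αT (w * cs.simple i * w⁻¹)) = ip f (αT (w * cs.simple j * w⁻¹)))

/-- The span of `{C_w : w ∈ K'}` inside `V_K`. -/
noncomputable def spanOf (F : Type*) [Field F] (K : Set W) (K' : Set W) :
    Submodule F (↥K →₀ F) :=
  Submodule.span F {x | ∃ (w : W) (h : w ∈ K), w ∈ K' ∧ x = Cvec F K w h}

/-- Minimality of a representation `ρ` of `W` on `V_K` as an AY pair: `K` is nonempty and
has no proper nonempty subset `K'` with `span{C_w : w ∈ K'}` invariant under `ρ`. -/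
def RepMinimal {F : Type*} [Field F] (K : Set W) (ρ : Representation F W (↥K →₀ F)) : Prop :=
  K.Nonempty ∧ ∀ K' : Set W, K' ⊆ K → K'.Nonempty →
    (∀ (g : W), ∀ x ∈ spanOf F K K', ρ g x ∈ spanOf F K K') → K' = K

/-- The basis vector `C_w` of `V_K` for `w ∈ K`, extended by zero to all of `W`. -/
noncomputable def extVec (K : Set W) (w : W) : ↥K →₀ ℝ :=
  open Classical in if h : w ∈ K then Cvec ℝ K w h else 0

theorem extVec_of_mem {G : Type*} {K : Set G} {w : G} (h : w ∈ K) : extVec K w = Cvec ℝ K w h := by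
  simp [extVec, h]

theorem extVec_of_notMem {G : Type*} {K : Set G} {w : G} (h : w ∉ K) : extVec K w = 0 := by
  simp [extVec, h]

theorem linearMap_ext_extVec {G : Type*} {K : Set G} {S T : (↥K →₀ ℝ) →ₗ[ℝ] (↥K →₀ ℝ)}
    (h : ∀ w ∈ K, S (extVec K w) = T (extVec K w)) : S = T := by
  refine Finsupp.lhom_ext' fun w => LinearMap.ext_ring ?_
  have := h w w.2
  rw [extVec_of_mem w.2] at this
  exact this

section LocalRelations

variable {V : Type*} [AddCommGroup V] [Module ℝ V]

theorem involutive_local {S : V →ₗ[ℝ] V} {x y : V} {p b b' : ℝ}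
    (hx : S x = p⁻¹ • x + b • y) (hy : S y = (-p)⁻¹ • y + b' • x)
    (hb : b * b' = 1 - p⁻¹ ^ 2) : S (S x) = x := by
  have hx' : (p⁻¹ * p⁻¹ + b * b') • x = x := by
    rw [hb]; ring_nf; simp
  rw [hx, map_add, map_smul, map_smul, hx, hy, inv_neg]
  refine Eq.trans ?_ hx'
  module

theorem commute_local {S T : V →ₗ[ℝ] V} {x xs xt y : V} {p q b₁ b₂ b₃ b₄ : ℝ}
    (h₁ : S x = p⁻¹ • x + b₁ • xs) (h₂ : T x = q⁻¹ • x + b₂ • xt)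
    (h₃ : T xs = q⁻¹ • xs + b₃ • y) (h₄ : S xt = p⁻¹ • xt + b₄ • y)
    (hb : b₁ * b₃ = b₂ * b₄) : S (T x) = T (S x) := by
  have hy : (b₁ * b₃) • y = (b₂ * b₄) • y := by rw [hb]
  rw [h₁, h₂, map_add, map_add, map_smul, map_smul, map_smul, map_smul, h₁, h₂, h₃, h₄]
  linear_combination (norm := module) (-1 : ℝ) • hy

theorem braid_local {S T : V →ₗ[ℝ] V} {x xs xt xst xts y : V}
    {p q b₁ b₁' b₂ b₂' b₃ b₄ b₅ b₆ : ℝ} (hp : p ≠ 0) (hq : q ≠ 0) (hpq : p + q ≠ 0)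
    (h₁ : S x = p⁻¹ • x + b₁ • xs) (h₂ : T x = q⁻¹ • x + b₂ • xt)
    (h₁' : S xs = (-p)⁻¹ • xs + b₁' • x) (h₂' : T xt = (-q)⁻¹ • xt + b₂' • x)
    (h₃ : T xs = (p + q)⁻¹ • xs + b₃ • xst) (h₄ : S xt = (p + q)⁻¹ • xt + b₄ • xts)
    (h₅ : S xst = q⁻¹ • xst + b₅ • y) (h₆ : T xts = p⁻¹ • xts + b₆ • y)
    (hb₁ : b₁ * b₁' = 1 - p⁻¹ ^ 2) (hb₂ : b₂ * b₂' = 1 - q⁻¹ ^ 2)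
    (hb : b₁ * b₃ * b₅ = b₂ * b₄ * b₆) : S (T (S x)) = T (S (T x)) := by
  have hS : S (T (S x)) = (p⁻¹ * p⁻¹ * q⁻¹ + (p + q)⁻¹ * (b₁ * b₁')) • x
      + (b₁ * (p⁻¹ * q⁻¹ - (p + q)⁻¹ * p⁻¹)) • xs + (b₂ * (p⁻¹ * (p + q)⁻¹)) • xt
      + (b₁ * b₃ * q⁻¹) • xst + (b₂ * b₄ * p⁻¹) • xts + (b₁ * b₃ * b₅) • y := by
    simp only [h₁, h₂, h₁', h₃, h₄, h₅, map_add, map_smul, inv_neg]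
    module
  have hT : T (S (T x)) = (q⁻¹ * q⁻¹ * p⁻¹ + (p + q)⁻¹ * (b₂ * b₂')) • x
      + (b₁ * (q⁻¹ * (p + q)⁻¹)) • xs + (b₂ * (p⁻¹ * q⁻¹ - (p + q)⁻¹ * q⁻¹)) • xt
      + (b₁ * b₃ * q⁻¹) • xst + (b₂ * b₄ * p⁻¹) • xts + (b₂ * b₄ * b₆) • y := by
    simp only [h₁, h₂, h₂', h₃, h₄, h₆, map_add, map_smul, inv_neg]
    module
  rw [hS, hT, hb₁, hb₂, hb]
  have hx : p⁻¹ * p⁻¹ * q⁻¹ + (p + q)⁻¹ * (1 - p⁻¹ ^ 2) =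
      q⁻¹ * q⁻¹ * p⁻¹ + (p + q)⁻¹ * (1 - q⁻¹ ^ 2) := by
    field_simp
    ring
  have hxs : p⁻¹ * q⁻¹ - (p + q)⁻¹ * p⁻¹ = q⁻¹ * (p + q)⁻¹ := by
    field_simp
    ring
  have hxt : p⁻¹ * q⁻¹ - (p + q)⁻¹ * q⁻¹ = p⁻¹ * (p + q)⁻¹ := by
    field_simp
    ring
  rw [hx, hxs, hxt]

end LocalRelations

theorem mul_pow_three_eq_one_of_braid {N : Type*} [Monoid N] {x y : N} (hx : x * x = 1)
    (hy : y * y = 1) (h : x * (y * x) = y * (x * y)) : (x * y) ^ 3 = 1 := by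
  calc (x * y) ^ 3 = x * (y * x) * (y * (x * y)) := by
        simp only [pow_succ, pow_zero, one_mul, mul_assoc]
    _ = y * (x * (y * y) * x) * y := by rw [h]; simp only [mul_assoc]
    _ = 1 := by rw [hy, mul_one, hx, mul_one, hy]

theorem simple_mul_comm_of_eq_two (cs : CoxeterSystem M W) {i j : B} (h : M i j = 2) :
    cs.simple j * cs.simple i = cs.simple i * cs.simple j := by
  have h' : M j i = 2 := by rw [M.symmetric]; exact h
  have := cs.wordProd_braidWord_eq i j
  simp only [CoxeterSystem.braidWord, h, h'] at this
  simpa [CoxeterSystem.alternatingWord, CoxeterSystem.wordProd, eq_comm] using this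

theorem simple_braid_of_eq_three (cs : CoxeterSystem M W) {i j : B} (h : M i j = 3) :
    cs.simple j * cs.simple i * cs.simple j = cs.simple i * cs.simple j * cs.simple i := by
  have h' : M j i = 3 := by rw [M.symmetric]; exact h
  have := cs.wordProd_braidWord_eq i j
  simp only [CoxeterSystem.braidWord, h, h'] at this
  simpa [CoxeterSystem.alternatingWord, CoxeterSystem.wordProd, mul_assoc, eq_comm] using this

/-- Local conditions on the coefficients under which the operators
`C_w ↦ c(w,s)⁻¹ C_w + b(w,s) C_{ws}` define a representation on `V_K`. -/
theorem exists_representation_of_coefficients (cs : CoxeterSystem M W) (hsl : SimplyLaced M)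
    (K : Set W) (c b : W → B → ℝ)
    (hc : ∀ w ∈ K, ∀ i, c w i ≠ 0)
    (hc_self : ∀ w i, c (w * cs.simple i) i = -c w i)
    (hc_two : ∀ w i j, M i j = 2 → c (w * cs.simple i) j = c w j)
    (hc_three : ∀ w i j, M i j = 3 → c (w * cs.simple i) j = c w i + c w j)
    (hc_add : ∀ w ∈ K, ∀ i j, M i j = 3 → c w i + c w j ≠ 0)
    (hb_left : ∀ w i, w ∉ K → b w i = 0)
    (hb_mul : ∀ w ∈ K, ∀ i, b w i * b (w * cs.simple i) i = 1 - (c w i)⁻¹ ^ 2)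
    (hb_two : ∀ w ∈ K, ∀ i j, M i j = 2 → b w i * b (w * cs.simple i) j =
      b w j * b (w * cs.simple j) i)
    (hb_three : ∀ w ∈ K, ∀ i j, M i j = 3 →
      b w i * b (w * cs.simple i) j * b (w * cs.simple i * cs.simple j) i =
      b w j * b (w * cs.simple j) i * b (w * cs.simple j * cs.simple i) j) :
    ∃ ρ : Representation ℝ W (↥K →₀ ℝ), ∀ w i, ρ (cs.simple i) (extVec K w) =
      (c w i)⁻¹ • extVec K w + b w i • extVec K (w * cs.simple i) := by
  obtain ⟨T, hT⟩ : ∃ T : B → Module.End ℝ (↥K →₀ ℝ), ∀ w i, T i (extVec K w) =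
      (c w i)⁻¹ • extVec K w + b w i • extVec K (w * cs.simple i) := by
    refine ⟨fun i => Finsupp.linearCombination ℝ fun w : K =>
      (c w i)⁻¹ • extVec K w.1 + b w i • extVec K (w * cs.simple i), fun w i => ?_⟩
    by_cases hw : w ∈ K
    · rw [extVec_of_mem hw]
      simp [Cvec, extVec_of_mem hw]
    · simp [extVec_of_notMem hw, hb_left w i hw]
  have hinv : ∀ i, T i * T i = 1 := by
    intro i
    refine linearMap_ext_extVec fun w hw => ?_
    have h' := hT (w * cs.simple i) i
    rw [hc_self, cs.simple_mul_simple_cancel_right] at h'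
    exact involutive_local (hT w i) h' (hb_mul w hw i)
  have hlift : M.IsLiftable T := by
    intro i j
    by_cases hij : i = j
    · subst hij
      simp [hinv]
    rcases hsl i j hij with h | h
    · have h' : M j i = 2 := by rw [M.symmetric]; exact h
      have hcomm : T i * T j = T j * T i := by
        refine linearMap_ext_extVec fun w hw => ?_
        have h₃ := hT (w * cs.simple i) j
        have h₄ := hT (w * cs.simple j) i
        rw [hc_two w i j h] at h₃
        have hrel : w * cs.simple j * cs.simple i = w * cs.simple i * cs.simple j := by
          rw [mul_assoc, mul_assoc, simple_mul_comm_of_eq_two cs h]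
        rw [hc_two w j i h', hrel] at h₄
        exact commute_local (hT w i) (hT w j) h₃ h₄ (hb_two w hw i j h)
      rw [h, pow_two, mul_assoc, ← mul_assoc (T j), ← hcomm, mul_assoc, hinv, mul_one, hinv]
    · have h' : M j i = 3 := by rw [M.symmetric]; exact h
      have hbraid : T i * (T j * T i) = T j * (T i * T j) := by
        refine linearMap_ext_extVec fun w hw => ?_
        have h₁ := hT (w * cs.simple i) i
        have h₂ := hT (w * cs.simple j) j
        have h₃ := hT (w * cs.simple i) j
        have h₄ := hT (w * cs.simple j) i
        have h₅ := hT (w * cs.simple i * cs.simple j) i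
        have h₆ := hT (w * cs.simple j * cs.simple i) j
        have hrel : w * cs.simple j * cs.simple i * cs.simple j =
            w * cs.simple i * cs.simple j * cs.simple i := by
          simpa only [mul_assoc] using congrArg (w * ·) (simple_braid_of_eq_three cs h)
        rw [hc_self, cs.simple_mul_simple_cancel_right] at h₁ h₂
        rw [hc_three w i j h] at h₃
        rw [hc_three w j i h', add_comm (c w j)] at h₄
        rw [hc_three _ j i h', hc_three w i j h, hc_self,
          show c w i + c w j + -c w i = c w j by ring] at h₅
        rw [hc_three _ i j h, hc_three w j i h', hc_self,
          show c w j + c w i + -c w j = c w i by ring, hrel] at h₆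
        simp only [Module.End.mul_apply]
        exact braid_local (hc w hw i) (hc w hw j) (hc_add w hw i j h) (hT w i) (hT w j)
          h₁ h₂ h₃ h₄ h₅ h₆ (hb_mul w hw i) (hb_mul w hw j) (hb_three w hw i j h)
      exact h ▸ mul_pow_three_eq_one_of_braid (hinv i) (hinv j) hbraid
  exact ⟨cs.lift ⟨T, hlift⟩, fun w i => by rw [cs.lift_apply_simple]; exact hT w i⟩

/-- A representation whose coefficients along the edges inside a convex set `K` do not vanish
is minimal. -/
theorem repMinimal_of_edge_coeff_ne_zero (cs : CoxeterSystem M W) {K : Set W}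
    (hconv : IsConvex cs K) (hK : K.Nonempty) (ρ : Representation ℝ W (↥K →₀ ℝ))
    (c b : W → B → ℝ)
    (hρ : ∀ w i, ρ (cs.simple i) (extVec K w) =
      (c w i)⁻¹ • extVec K w + b w i • extVec K (w * cs.simple i))
    (hb : ∀ w i, w ∈ K → w * cs.simple i ∈ K → b w i ≠ 0) : RepMinimal K ρ := by
  refine ⟨hK, fun K' hK' ⟨w₀, hw₀⟩ hinv => hK'.antisymm fun w hw => ?_⟩
  have hmem : ∀ x ∈ spanOf ℝ K K', ∀ v : K, x v ≠ 0 → v.1 ∈ K' := by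
    intro x hx v
    contrapose!
    intro hv
    induction hx using Submodule.span_induction with
    | mem x hx =>
      obtain ⟨u, hu, huK', rfl⟩ := hx
      have : (⟨u, hu⟩ : K) ≠ v := fun h => hv (h ▸ huK')
      simp [Cvec, this]
    | zero => simp
    | add x y _ _ hx hy => simp [hx, hy]
    | smul a x _ hx => simp [hx]
  have hstep : ∀ u i, u ∈ K' → u * cs.simple i ∈ K → u * cs.simple i ∈ K' := by
    intro u i hu hui
    refine hmem _ (hinv (cs.simple i) _ (Submodule.subset_span ⟨u, hK' hu, hu, rfl⟩))
      ⟨u * cs.simple i, hui⟩ ?_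
    have hne : u ≠ u * cs.simple i := fun h => cs.length_mul_simple_ne u i (by rw [← h])
    rw [← extVec_of_mem, hρ, extVec_of_mem (hK' hu), extVec_of_mem hui]
    simpa [Cvec, hne] using hb u i (hK' hu) hui
  obtain ⟨l, hl, hl'⟩ := cs.exists_isReduced (w₀⁻¹ * w)
  have hlK := hconv w₀ (hK' hw₀) w hw l (by rw [← hl', mul_inv_cancel_left])
    (by rw [hl', hl.eq])
  have hpath : ∀ n ≤ l.length, w₀ * cs.wordProd (l.take n) ∈ K' := by
    intro n
    induction n with
    | zero => intro _; simpa using hw₀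
    | succ n ih =>
      intro hn
      have h := hlK (n + 1) hn
      rw [List.take_succ_eq_append_getElem (by omega), cs.wordProd_append,
        cs.wordProd_singleton, ← mul_assoc] at h ⊢
      exact hstep _ _ (ih (by omega)) h
  have := hpath l.length le_rfl
  rwa [List.take_length, ← hl', mul_inv_cancel_left] at this

section GeometricRepresentation

variable [DecidableEq B] {cs : CoxeterSystem M W} {σ : Representation ℝ W (B → ℝ)}

theorem geometric_single_ne_zero (w : W) (i : B) : σ w (Pi.single i 1) ≠ 0 := by
  intro h
  have h' : σ (w⁻¹ * w) (Pi.single i 1) = 0 := by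
    rw [map_mul, Module.End.mul_apply, h, map_zero]
  simp at h'

variable [Fintype B]

theorem bform_single_single (i j : B) :
    bform M (Pi.single i 1) (Pi.single j 1) = -Real.cos (Real.pi / (M i j : ℝ)) := by
  simp [bform, Pi.single_apply]

theorem geometric_mul_simple_self
    (hσ : ∀ (i : B) (v : B → ℝ), σ (cs.simple i) v =
      v - (2 * bform M v (Pi.single i 1 : B → ℝ)) • (Pi.single i 1 : B → ℝ)) (w : W) (i : B) :
    σ (w * cs.simple i) (Pi.single i 1) = -σ w (Pi.single i 1) := by
  rw [map_mul, Module.End.mul_apply, hσ, bform_single_single, M.diagonal, map_sub, map_smul]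
  simp
  module

theorem geometric_mul_simple_of_eq_two
    (hσ : ∀ (i : B) (v : B → ℝ), σ (cs.simple i) v =
      v - (2 * bform M v (Pi.single i 1 : B → ℝ)) • (Pi.single i 1 : B → ℝ)) (w : W) {i j : B}
    (h : M i j = 2) : σ (w * cs.simple i) (Pi.single j 1) = σ w (Pi.single j 1) := by
  rw [map_mul, Module.End.mul_apply, hσ, bform_single_single, M.symmetric, h]
  simp

theorem geometric_mul_simple_of_eq_three
    (hσ : ∀ (i : B) (v : B → ℝ), σ (cs.simple i) v =
      v - (2 * bform M v (Pi.single i 1 : B → ℝ)) • (Pi.single i 1 : B → ℝ)) (w : W) {i j : B}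
    (h : M i j = 3) :
    σ (w * cs.simple i) (Pi.single j 1) = σ w (Pi.single i 1) + σ w (Pi.single j 1) := by
  rw [map_mul, Module.End.mul_apply, hσ, bform_single_single, M.symmetric, h, map_sub, map_smul]
  simp [Real.cos_pi_div_three]
  module

theorem simple_ne_of_geometric
    (hσ : ∀ (i : B) (v : B → ℝ), σ (cs.simple i) v =
      v - (2 * bform M v (Pi.single i 1 : B → ℝ)) • (Pi.single i 1 : B → ℝ)) {i j : B}
    (hij : i ≠ j) : cs.simple i ≠ cs.simple j := by
  intro h
  have h' := congrFun (congrArg (fun g => σ g (Pi.single i 1)) h) i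
  simp only [hσ, bform_single_single, M.diagonal] at h'
  simp [hij] at h'

theorem length_simple_mul_simple_of_geometric
    (hσ : ∀ (i : B) (v : B → ℝ), σ (cs.simple i) v =
      v - (2 * bform M v (Pi.single i 1 : B → ℝ)) • (Pi.single i 1 : B → ℝ)) {i j : B}
    (hij : i ≠ j) : cs.length (cs.simple i * cs.simple j) = 2 := by
  have h := cs.length_mul_simple (cs.simple i) j
  rw [cs.length_simple] at h
  rcases h with h | h
  · exact h
  · have h0 : cs.length (cs.simple i * cs.simple j) = 0 := by omega
    rw [cs.length_eq_zero_iff, mul_eq_one_iff_eq_inv, cs.inv_simple] at h0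
    exact absurd h0 (simple_ne_of_geometric hσ hij)

theorem length_braid_of_geometric
    (hσ : ∀ (i : B) (v : B → ℝ), σ (cs.simple i) v =
      v - (2 * bform M v (Pi.single i 1 : B → ℝ)) • (Pi.single i 1 : B → ℝ)) {i j : B}
    (hij : i ≠ j) (h : M i j = 3) :
    cs.length (cs.simple i * cs.simple j * cs.simple i) = 3 := by
  have hl := cs.length_mul_simple (cs.simple i * cs.simple j) i
  rw [length_simple_mul_simple_of_geometric hσ hij] at hl
  rcases hl with hl | hl
  · exact hl
  exfalso
  obtain ⟨k, hk⟩ := cs.length_eq_one_iff.1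
    (show cs.length (cs.simple i * cs.simple j * cs.simple i) = 1 by omega)
  have h' : M j i = 3 := by rw [M.symmetric]; exact h
  have hs : σ (cs.simple i * cs.simple j * cs.simple i) (Pi.single i 1) =
      -(Pi.single j 1 : B → ℝ) := by
    have hi := geometric_mul_simple_self hσ 1 i
    have hj := geometric_mul_simple_of_eq_three hσ 1 h
    simp only [one_mul, map_one, Module.End.one_apply] at hi hj
    rw [geometric_mul_simple_self hσ, geometric_mul_simple_of_eq_three hσ _ h', hi, hj]
    module
  rw [hk] at hs
  by_cases hki : k = i
  · subst hki
    have hi := geometric_mul_simple_self hσ 1 k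
    simp only [one_mul, map_one, Module.End.one_apply] at hi
    have := congrFun (hi.symm.trans hs) k
    simp [hij] at this
  · rw [hσ] at hs
    have := congrFun hs i
    simp [hij, Ne.symm hki] at this

end GeometricRepresentation

theorem IsConvex.mem_of_mul_pair {cs : CoxeterSystem M W} {K : Set W} (hconv : IsConvex cs K)
    {w : W} {i j : B} (hw : w ∈ K) (h : w * cs.simple i * cs.simple j ∈ K)
    (hl : cs.length (cs.simple i * cs.simple j) = 2) : w * cs.simple i ∈ K := by
  have := hconv w hw _ h [i, j] (by simp [cs.wordProd_cons, mul_assoc])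
    (by simp [mul_assoc, hl]) 1 (by simp)
  simpa using this

theorem IsConvex.mem_of_mul_triple {cs : CoxeterSystem M W} {K : Set W} (hconv : IsConvex cs K)
    {w : W} {i j k : B} (hw : w ∈ K) (h : w * cs.simple i * cs.simple j * cs.simple k ∈ K)
    (hl : cs.length (cs.simple i * cs.simple j * cs.simple k) = 3) :
    w * cs.simple i ∈ K ∧ w * cs.simple i * cs.simple j ∈ K := by
  have hn := hconv w hw _ h [i, j, k] (by simp [cs.wordProd_cons, mul_assoc])
    (by simpa [mul_assoc] using hl.symm)
  exact ⟨by simpa using hn 1 (by simp),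
    by simpa [cs.wordProd_cons, mul_assoc] using hn 2 (by simp)⟩

theorem IsConvex.mem_of_length_lt {cs : CoxeterSystem M W} {K : Set W} (hconv : IsConvex cs K)
    (h1K : (1 : W) ∈ K) {w : W} {i : B} (hw : w ∈ K)
    (hlt : cs.length (w * cs.simple i) < cs.length w) : w * cs.simple i ∈ K := by
  obtain ⟨l, hl, hl'⟩ := cs.exists_isReduced (w * cs.simple i)
  have hw' : cs.wordProd (l ++ [i]) = w := by
    rw [cs.wordProd_append, ← hl', cs.wordProd_singleton, cs.simple_mul_simple_cancel_right]
  have hlen := cs.length_mul_simple w i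
  have hll : cs.length (w * cs.simple i) = l.length := by rw [hl', hl.eq]
  have := hconv 1 h1K w hw (l ++ [i]) (by rw [one_mul, hw'])
    (by rw [inv_one, one_mul, List.length_append, List.length_singleton]; omega)
    l.length (by simp)
  rwa [List.take_left, one_mul, ← hl'] at this

/-- for an irreducible simply laced Coxeter system, a convex `K ∋ 1`, and a
`K`-generic `f`, the coefficients `ȧ_t = 1/⟨f,α_t⟩`, `ä_t = −ȧ_t` and any `ḃ_t, b̈_t` with
`ḃ_t·b̈_t = 1 − ȧ_t²` define a representation of `W` making `(ρ, K)` a minimal AY pair. -/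
theorem stmt14 [DecidableEq B] [Fintype B] (cs : CoxeterSystem M W)
    (hsl : SimplyLaced M) (hirr : IrreducibleCox M)
    (K : Set W) (hconv : IsConvex cs K) (h1K : (1 : W) ∈ K)
    -- the standard geometric representation σ of W on the root space V = B → ℝ
    (σ : Representation ℝ W (B → ℝ))
    (hσ : ∀ (i : B) (v : B → ℝ),
      σ (cs.simple i) v = v - (2 * bform M v (Pi.single i 1 : B → ℝ)) • (Pi.single i 1 : B → ℝ))
    -- an arbitrary positive definite bilinear form ⟨·,·⟩ on V
    (ip : (B → ℝ) →ₗ[ℝ] (B → ℝ) →ₗ[ℝ] ℝ)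
    (hsymm : ∀ u v : B → ℝ, ip u v = ip v u)
    (hpos : ∀ v : B → ℝ, v ≠ 0 → 0 < ip v v)
    -- the positive root α_t associated to each reflection t
    (αT : W → (B → ℝ))
    (hαT : ∀ (w : W) (i : B), cs.length w < cs.length (w * cs.simple i) →
      αT (w * cs.simple i * w⁻¹) = σ w (Pi.single i 1 : B → ℝ))
    (f : B → ℝ) (hf : KGeneric cs K ip αT f)
    (bd bBar : W → ℝ)
    (hb : ∀ t ∈ TK cs K, bd t * bBar t = 1 - ((ip f (αT t))⁻¹) ^ 2) :
    ∃ ρ : Representation ℝ W (↥K →₀ ℝ),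
      (∀ (i : B) (w : W) (hw : w ∈ K),
        (∀ h : w * cs.simple i ∈ K, cs.length w < cs.length (w * cs.simple i) →
          ρ (cs.simple i) (Cvec ℝ K w hw) =
            (ip f (αT (w * cs.simple i * w⁻¹)))⁻¹ • Cvec ℝ K w hw +
            bd (w * cs.simple i * w⁻¹) • Cvec ℝ K (w * cs.simple i) h) ∧
        (w * cs.simple i ∉ K → cs.length w < cs.length (w * cs.simple i) →
          ρ (cs.simple i) (Cvec ℝ K w hw) =
            (ip f (αT (w * cs.simple i * w⁻¹)))⁻¹ • Cvec ℝ K w hw) ∧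
        (cs.length (w * cs.simple i) < cs.length w →
          ∃ h : w * cs.simple i ∈ K,
            ρ (cs.simple i) (Cvec ℝ K w hw) =
              (-(ip f (αT (w * cs.simple i * w⁻¹)))⁻¹) • Cvec ℝ K w hw +
              bBar (w * cs.simple i * w⁻¹) • Cvec ℝ K (w * cs.simple i) h)) ∧
      RepMinimal K ρ := by
  classical
  obtain ⟨hf₁, hf₂, hf₃⟩ := hf
  let r : W → B → B → ℝ := fun w i => σ w (Pi.single i 1)
  have hr_ne : ∀ w i, r w i ≠ -r w i := fun w i h =>
    geometric_single_ne_zero (σ := σ) w i (self_eq_neg.1 h)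
  have hr_self : ∀ w i, r (w * cs.simple i) i = -r w i := geometric_mul_simple_self hσ
  have hr_two : ∀ w i j, M i j = 2 → r (w * cs.simple i) j = r w j := fun w _ _ =>
    geometric_mul_simple_of_eq_two hσ w
  have hr_three : ∀ w i j, M i j = 3 → r (w * cs.simple i) j = r w i + r w j := fun w _ _ =>
    geometric_mul_simple_of_eq_three hσ w
  have hconj : ∀ w i, w * cs.simple i * cs.simple i * (w * cs.simple i)⁻¹ =
      w * cs.simple i * w⁻¹ := fun w i => by simp [mul_assoc]
  have hconj_of_eq : ∀ w {i j} {g : W}, cs.simple i * cs.simple j * cs.simple i = g →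
      w * cs.simple i * cs.simple j * (w * cs.simple i)⁻¹ = w * g * w⁻¹ := by
    rintro w i j _ rfl
    simp [mul_assoc]
  have hconj_hexagon : ∀ w {i j}, M i j = 3 → w * cs.simple i * cs.simple j * cs.simple i *
      (w * cs.simple i * cs.simple j)⁻¹ = w * cs.simple j * w⁻¹ := by
    intro w i j h
    rw [hconj_of_eq (w * cs.simple i) (simple_braid_of_eq_three cs h)]
    simp [mul_assoc]
  have hα_up : ∀ w i, cs.length w < cs.length (w * cs.simple i) →
      αT (w * cs.simple i * w⁻¹) = r w i := hαT
  have hα_down : ∀ w i, cs.length (w * cs.simple i) < cs.length w →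
      αT (w * cs.simple i * w⁻¹) = -r w i := by
    intro w i h
    rw [← hconj, ← hr_self]
    exact hαT _ i (by rwa [cs.simple_mul_simple_cancel_right])
  have hα : ∀ w i, αT (w * cs.simple i * w⁻¹) = r w i ∨
      αT (w * cs.simple i * w⁻¹) = -r w i := fun w i =>
    (cs.length_mul_simple_ne w i).lt_or_gt.elim (fun h => .inr (hα_down w i h))
      (fun h => .inl (hα_up w i h))
  let c : W → B → ℝ := fun w i => ip f (r w i)
  have hcα : ∀ w i, ip f (αT (w * cs.simple i * w⁻¹)) = c w i ∨
      ip f (αT (w * cs.simple i * w⁻¹)) = -c w i := by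
    intro w i
    rcases hα w i with h | h <;> simp [h, c]
  let β : W → (B → ℝ) → ℝ := fun t v => if αT t = v then bd t else bBar t
  let b : W → B → ℝ := fun w i =>
    if w ∈ K ∧ w * cs.simple i ∈ K then β (w * cs.simple i * w⁻¹) (r w i) else 0
  have hb_mem : ∀ {w i}, w ∈ K → w * cs.simple i ∈ K →
      b w i = β (w * cs.simple i * w⁻¹) (r w i) := fun h h' => if_pos ⟨h, h'⟩
  have hb_left : ∀ w i, w ∉ K → b w i = 0 := fun w i h => if_neg fun h' => h h'.1
  have hb_right : ∀ w i, w * cs.simple i ∉ K → b w i = 0 := fun w i h => if_neg fun h' => h h'.2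
  have hb_opposite : ∀ {w i w' j}, w ∈ K → w * cs.simple i ∈ K → w' ∈ K →
      w' * cs.simple j ∈ K → w * cs.simple i * w⁻¹ = w' * cs.simple j * w'⁻¹ →
      r w i = r w' j → b w i = b w' j := by
    intro w i w' j h₁ h₂ h₃ h₄ ht hr
    rw [hb_mem h₁ h₂, hb_mem h₃ h₄, ht, hr]
  have hb_mul_mem : ∀ w i, w ∈ K → w * cs.simple i ∈ K →
      b w i * b (w * cs.simple i) i = 1 - (c w i)⁻¹ ^ 2 := by
    intro w i hw hwi
    have hbt := hb (w * cs.simple i * w⁻¹) ⟨i, w, hw, hwi, rfl⟩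
    rw [hb_mem hw hwi, hb_mem hwi (by rwa [cs.simple_mul_simple_cancel_right]), hconj, hr_self]
    have hne := hr_ne w i
    rcases hα w i with h | h
    · simp only [β, h, hne, if_true, if_false]
      rw [hbt, h]
    · simp only [β, h, hne.symm, if_true, if_false]
      rw [mul_comm, hbt, h]
      simp [c]
  have hc_bdry : ∀ w i, w ∈ K → w * cs.simple i ∉ K → c w i = 1 ∨ c w i = -1 := by
    intro w i hw hwi
    have h := hf₂ _ ⟨i, w, hw, hwi, rfl⟩
    rcases hcα w i with h' | h' <;> rw [h'] at h
    · exact h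
    · rcases h with h | h
      · right; linarith
      · left; linarith
  have hc_int : ∀ w i, w ∈ K → w * cs.simple i ∈ K → c w i ≠ 0 ∧ c w i ≠ 1 ∧ c w i ≠ -1 := by
    intro w i hw hwi
    obtain ⟨h₁, h₂, h₃⟩ := hf₁ _ ⟨i, w, hw, hwi, rfl⟩
    rcases hcα w i with h' | h' <;> rw [h'] at h₁ h₂ h₃
    · exact ⟨h₁, h₂, h₃⟩
    · exact ⟨fun h => h₁ (by simp [h]), fun h => h₃ (by simp [h]), fun h => h₂ (by simp [h])⟩
  have hc : ∀ w ∈ K, ∀ i, c w i ≠ 0 := by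
    intro w hw i
    by_cases hwi : w * cs.simple i ∈ K
    · exact (hc_int w i hw hwi).1
    · rcases hc_bdry w i hw hwi with h | h <;> rw [h] <;> norm_num
  have hc_self : ∀ w i, c (w * cs.simple i) i = -c w i := by
    intro w i
    simp only [c, hr_self, map_neg]
  have hc_two : ∀ w i j, M i j = 2 → c (w * cs.simple i) j = c w j := by
    intro w i j h
    simp only [c, hr_two w i j h]
  have hc_three : ∀ w i j, M i j = 3 → c (w * cs.simple i) j = c w i + c w j := by
    intro w i j h
    simp only [c, hr_three w i j h, map_add]
  have hmem_down : ∀ {w i}, w ∈ K → cs.length (w * cs.simple i) < cs.length w →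
      w * cs.simple i ∈ K := fun hw h => hconv.mem_of_length_lt h1K hw h
  have hup : ∀ {w i}, w ∈ K → w * cs.simple i ∉ K →
      cs.length w < cs.length (w * cs.simple i) := by
    intro w i hw hwi
    refine (cs.length_mul_simple_ne w i).lt_or_gt.resolve_left fun h => hwi (hmem_down hw h)
  have hM_ne : ∀ {i j}, M i j = 2 ∨ M i j = 3 → i ≠ j := by
    rintro i _ h rfl
    simp at h
  have hM_swap : ∀ {i j n}, M i j = n → M j i = n := fun {i j n} h => by rwa [M.symmetric]
  obtain ⟨ρ, hρ⟩ := exists_representation_of_coefficients cs hsl K c b hc hc_self hc_two hc_three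
    (by
      intro w hw i j h
      by_cases hi : w * cs.simple i ∈ K
      · rw [← hc_three w i j h]
        exact hc _ hi j
      by_cases hj : w * cs.simple j ∈ K
      · rw [add_comm, ← hc_three w j i (hM_swap h)]
        exact hc _ hj i
      have heq := hf₃ w hw i j h hi hj
      rw [hα_up w i (hup hw hi), hα_up w j (hup hw hj)] at heq
      change c w i = c w j at heq
      rw [← heq, ← two_mul]
      exact mul_ne_zero two_ne_zero (hc w hw i))
    hb_left
    (by
      intro w hw i
      by_cases hwi : w * cs.simple i ∈ K
      · exact hb_mul_mem w i hw hwi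
      · rw [hb_right w i hwi]
        rcases hc_bdry w i hw hwi with h | h <;> rw [h] <;> norm_num)
    (by
      intro w hw i j h
      have hij := hM_ne (.inl h)
      have hst := simple_mul_comm_of_eq_two cs h
      have hrel : w * cs.simple j * cs.simple i = w * cs.simple i * cs.simple j := by
        rw [mul_assoc, hst, mul_assoc]
      by_cases hm : w * cs.simple i * cs.simple j ∈ K
      · have hm' := hrel ▸ hm
        have hi := hconv.mem_of_mul_pair hw hm (length_simple_mul_simple_of_geometric hσ hij)
        have hj := hconv.mem_of_mul_pair hw hm'
          (length_simple_mul_simple_of_geometric hσ hij.symm)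
        rw [mul_comm, hb_opposite hi hm hw hj
            (hconj_of_eq w (by rw [← hst, cs.simple_mul_simple_cancel_right])) (hr_two w i j h),
          hb_opposite hj hm' hw hi
            (hconj_of_eq w (by rw [hst, cs.simple_mul_simple_cancel_right]))
            (hr_two w j i (hM_swap h))]
      · have hm' : w * cs.simple j * cs.simple i ∉ K := by rwa [hrel]
        rw [hb_right _ j hm, hb_right _ i hm', mul_zero, mul_zero])
    (by
      intro w hw i j h
      have hij := hM_ne (.inr h)
      have hst := simple_braid_of_eq_three cs h
      have hrel : w * cs.simple j * cs.simple i * cs.simple j =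
          w * cs.simple i * cs.simple j * cs.simple i := by
        simpa only [mul_assoc] using congrArg (w * ·) hst
      by_cases hm : w * cs.simple i * cs.simple j * cs.simple i ∈ K
      · have hm' := hrel ▸ hm
        obtain ⟨hi, hi'⟩ := hconv.mem_of_mul_triple hw hm (length_braid_of_geometric hσ hij h)
        obtain ⟨hj, hj'⟩ := hconv.mem_of_mul_triple hw hm'
          (length_braid_of_geometric hσ hij.symm (hM_swap h))
        have h₁ : b (w * cs.simple i * cs.simple j) i = b w j :=
          hb_opposite hi' hm hw hj
            (hconj_hexagon w h)
            (by rw [hr_three _ j i (hM_swap h), hr_three w i j h, hr_self]; abel)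
        have h₂ : b (w * cs.simple j * cs.simple i) j = b w i :=
          hb_opposite hj' hm' hw hi
            (hconj_hexagon w (hM_swap h))
            (by rw [hr_three _ i j h, hr_three w j i (hM_swap h), hr_self]; abel)
        have h₃ : b (w * cs.simple i) j = b (w * cs.simple j) i :=
          hb_opposite hi hi' hj hj' (by rw [hconj_of_eq w rfl, hconj_of_eq w rfl, hst])
            (by rw [hr_three w i j h, hr_three w j i (hM_swap h), add_comm])
        rw [h₁, h₂, h₃]
        ring
      · have hm' : w * cs.simple j * cs.simple i * cs.simple j ∉ K := by rwa [hrel]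
        rw [hb_right _ i hm, hb_right _ j hm', mul_zero, mul_zero])
  refine ⟨ρ, fun i w hw => ⟨fun hwi hlt => ?_, fun hwi hlt => ?_, fun hlt => ?_⟩,
    repMinimal_of_edge_coeff_ne_zero cs hconv ⟨1, h1K⟩ ρ c b hρ fun w i hw hwi hb0 => ?_⟩
  · have h := hρ w i
    rw [extVec_of_mem hw, extVec_of_mem hwi, hb_mem hw hwi] at h
    simpa [β, hα_up w i hlt, c] using h
  · have h := hρ w i
    rw [extVec_of_mem hw, extVec_of_notMem hwi, smul_zero, add_zero] at h
    simpa [hα_up w i hlt] using h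
  · refine ⟨hmem_down hw hlt, ?_⟩
    have h := hρ w i
    rw [extVec_of_mem hw, extVec_of_mem (hmem_down hw hlt), hb_mem hw (hmem_down hw hlt)] at h
    simpa [β, hα_down w i hlt, c, (hr_ne w i).symm] using h
  · have h := hb_mul_mem w i hw hwi
    obtain ⟨h₀, h₁, h₂⟩ := hc_int w i hw hwi
    rw [hb0, zero_mul, inv_pow, eq_comm, sub_eq_zero, eq_comm, inv_eq_one, sq_eq_one_iff] at h
    exact h.elim h₁ h₂
end

section
/- Let (W,S) be an irreducible simply laced Coxeter system and let K ⊆ W contain the identity element. Let (ρ,K) be a minimal AY pair over ℝ satisfying Axiom (B), and suppose ȧ_t ≠ 0 for all t ∈ T_K. Then there exists a K-generic vector f ∈ V such that ȧ_t = 1/⟨f,α_t⟩ for all t ∈ T_K ∪ T_∂K. -/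
open CoxeterSystem

variable {B W : Type*} [Group W] {M : CoxeterMatrix B}

/-- An AY pair `(ρ, K)` (a representation of `W` on `V_K`) satisfying Axiom (B),
with coefficient data `ȧ, ä, ḃ, b̈` indexed by reflections. -/
structure AYRepB (cs : CoxeterSystem M W) (F : Type*) [Field F] (K : Set W) where
  ρ : Representation F W (↥K →₀ F)
  ad : W → F  -- ȧ
  aBar : W → F  -- ä
  bd : W → F  -- ḃ
  bBar : W → F  -- b̈
  axiomB_lt_mem : ∀ (i : B) (w : W) (hw : w ∈ K) (h : w * cs.simple i ∈ K),
    cs.length w < cs.length (w * cs.simple i) →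
    ρ (cs.simple i) (Cvec F K w hw) = ad (w * cs.simple i * w⁻¹) • Cvec F K w hw +
      bd (w * cs.simple i * w⁻¹) • Cvec F K (w * cs.simple i) h
  axiomB_lt_not_mem : ∀ (i : B) (w : W) (hw : w ∈ K), w * cs.simple i ∉ K →
    cs.length w < cs.length (w * cs.simple i) →
    ρ (cs.simple i) (Cvec F K w hw) = ad (w * cs.simple i * w⁻¹) • Cvec F K w hw
  axiomB_gt_mem : ∀ (i : B) (w : W) (hw : w ∈ K) (h : w * cs.simple i ∈ K),
    cs.length (w * cs.simple i) < cs.length w →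
    ρ (cs.simple i) (Cvec F K w hw) = aBar (w * cs.simple i * w⁻¹) • Cvec F K w hw +
      bBar (w * cs.simple i * w⁻¹) • Cvec F K (w * cs.simple i) h
  axiomB_gt_not_mem : ∀ (i : B) (w : W) (hw : w ∈ K), w * cs.simple i ∉ K →
    cs.length (w * cs.simple i) < cs.length w →
    ρ (cs.simple i) (Cvec F K w hw) = aBar (w * cs.simple i * w⁻¹) • Cvec F K w hw
  bd_eq_zero : ∀ (i : B) (w : W), w ∈ K → w * cs.simple i ∉ K →
    cs.length w < cs.length (w * cs.simple i) → bd (w * cs.simple i * w⁻¹) = 0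
  bBar_eq_zero : ∀ (i : B) (w : W), w ∈ K → w * cs.simple i ∉ K →
    cs.length (w * cs.simple i) < cs.length w → bBar (w * cs.simple i * w⁻¹) = 0

/-- Minimality: `K` is nonempty and has no proper nonempty subset `K'` with
`span{C_w : w ∈ K'}` invariant under `ρ`. -/
def AYRepB.Minimal {cs : CoxeterSystem M W} {F : Type*} [Field F] {K : Set W}
    (P : AYRepB cs F K) : Prop :=
  K.Nonempty ∧ ∀ K' : Set W, K' ⊆ K → K'.Nonempty →
    (∀ (g : W), ∀ x ∈ spanOf F K K', P.ρ g x ∈ spanOf F K K') → K' = K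

namespace AYRepB

variable {cs : CoxeterSystem M W} {F : Type*} [Field F] {K : Set W} (P : AYRepB cs F K)

open Classical in
/-- The coefficient of `C_u` in a vector of `V_K`, taken to be `0` when `u ∉ K`. -/
noncomputable def coord (F : Type*) [Field F] (K : Set W) (u : W) : (↥K →₀ F) →ₗ[F] F :=
  if h : u ∈ K then Finsupp.lapply ⟨u, h⟩ else 0

open Classical in
theorem coord_Cvec {W : Type*} {K : Set W} (u w : W) (hw : w ∈ K) :
    coord F K u (Cvec F K w hw) = if u = w then 1 else 0 := by
  unfold coord Cvec
  by_cases hu : u ∈ K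
  · by_cases h : u = w
    · simp [h, hw]
    · simp [h, hu]
  · have : u ≠ w := fun h => hu (h ▸ hw)
    simp [hu, this]

/-- The diagonal coefficient of `ρ_i` at `C_u`. -/
noncomputable def diag (i : B) (u : W) : F :=
  if cs.length u < cs.length (u * cs.simple i) then P.ad (u * cs.simple i * u⁻¹)
  else P.aBar (u * cs.simple i * u⁻¹)

open Classical in
/-- The coefficient of `C_{us}` in `ρ_s(C_u)`, taken to be `0` unless `u, us ∈ K`. -/
noncomputable def off (i : B) (u : W) : F :=
  if u ∈ K ∧ u * cs.simple i ∈ K then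
    if cs.length u < cs.length (u * cs.simple i) then P.bd (u * cs.simple i * u⁻¹)
    else P.bBar (u * cs.simple i * u⁻¹)
  else 0

theorem mem_of_off_ne_zero {i : B} {u : W} (h : P.off i u ≠ 0) :
    u ∈ K ∧ u * cs.simple i ∈ K := by
  by_contra h'
  exact h (by simp [off, h'])

theorem length_lt_of_not_lt {u : W} {i : B}
    (h : ¬ cs.length u < cs.length (u * cs.simple i)) :
    cs.length (u * cs.simple i) < cs.length u :=
  lt_of_le_of_ne (not_lt.mp h) (cs.length_mul_simple_ne u i)

theorem rho_Cvec_mem (i : B) (w : W) (hw : w ∈ K) (h : w * cs.simple i ∈ K) :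
    P.ρ (cs.simple i) (Cvec F K w hw) =
      P.diag i w • Cvec F K w hw + P.off i w • Cvec F K (w * cs.simple i) h := by
  by_cases hl : cs.length w < cs.length (w * cs.simple i)
  · simp [diag, off, hw, h, hl, P.axiomB_lt_mem i w hw h hl]
  · simp [diag, off, hw, h, hl, P.axiomB_gt_mem i w hw h (length_lt_of_not_lt hl)]

theorem rho_Cvec_not_mem (i : B) (w : W) (hw : w ∈ K) (h : w * cs.simple i ∉ K) :
    P.ρ (cs.simple i) (Cvec F K w hw) = P.diag i w • Cvec F K w hw := by
  by_cases hl : cs.length w < cs.length (w * cs.simple i)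
  · simp [diag, hl, P.axiomB_lt_not_mem i w hw h hl]
  · simp [diag, hl, P.axiomB_gt_not_mem i w hw h (length_lt_of_not_lt hl)]

theorem coord_rho (i : B) (u : W) (x : ↥K →₀ F) :
    coord F K u (P.ρ (cs.simple i) x) =
      P.diag i u * coord F K u x +
        P.off i (u * cs.simple i) * coord F K (u * cs.simple i) x := by
  classical
  induction x using Finsupp.induction_linear with
  | zero => simp
  | add f g hf hg => simp only [map_add, hf, hg]; ring
  | single a c =>
    obtain ⟨w, hw⟩ := a
    have hs : Finsupp.single (⟨w, hw⟩ : K) c = c • Cvec F K w hw := by simp [Cvec]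
    have hiff : u * cs.simple i = w ↔ u = w * cs.simple i := by
      constructor
      · rintro rfl; simp
      · rintro rfl; simp
    have hi1 : cs.simple i ≠ 1 := fun e => by simpa [e] using cs.length_simple i
    rw [hs]
    by_cases h : w * cs.simple i ∈ K
    · simp only [map_smul, P.rho_Cvec_mem i w hw h, map_add, coord_Cvec, hiff, smul_eq_mul]
      by_cases h1 : u = w <;> by_cases h2 : u = w * cs.simple i
      · exact absurd (congrArg cs.length (h1.symm.trans h2))
          (cs.length_mul_simple_ne w i).symm
      all_goals simp [h1, h2, hi1]
      all_goals ring
    · simp only [map_smul, P.rho_Cvec_not_mem i w hw h, coord_Cvec, hiff, smul_eq_mul]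
      have h0 : P.off i w = 0 := by simp [off, h]
      by_cases h1 : u = w <;> by_cases h2 : u = w * cs.simple i
      · exact absurd (congrArg cs.length (h1.symm.trans h2))
          (cs.length_mul_simple_ne w i).symm
      all_goals simp [h1, h2, h0, hi1]
      all_goals ring

/-- The product of the off-diagonal coefficients along the path from `w` spelled by a word. -/
noncomputable def pathCoeff : List B → W → F
  | [], _ => 1
  | i :: l, w => P.off i w * pathCoeff l (w * cs.simple i)

theorem pathCoeff_concat (l : List B) (i : B) (w : W) :
    P.pathCoeff (l ++ [i]) w = P.pathCoeff l w * P.off i (w * cs.wordProd l) := by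
  induction l generalizing w with
  | nil => simp [pathCoeff]
  | cons j l ih => simp [pathCoeff, ih, cs.wordProd_cons, mul_assoc]

theorem mem_of_pathCoeff_ne_zero {l : List B} {w : W} (hw : w ∈ K)
    (h : P.pathCoeff l w ≠ 0) : w * cs.wordProd l ∈ K := by
  induction l generalizing w with
  | nil => simpa using hw
  | cons i l ih =>
    simp only [pathCoeff] at h
    have := ih (P.mem_of_off_ne_zero (left_ne_zero_of_mul h)).2 (right_ne_zero_of_mul h)
    rwa [cs.wordProd_cons, ← mul_assoc]

theorem rho_inv_wordProd_concat (l : List B) (i : B) (x : ↥K →₀ F) :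
    P.ρ (cs.wordProd (l ++ [i]))⁻¹ x = P.ρ (cs.simple i) (P.ρ (cs.wordProd l)⁻¹ x) := by
  rw [cs.wordProd_append, mul_inv_rev, map_mul]
  simp

theorem coord_rho_inv_wordProd_eq_zero (w : W) (hw : w ∈ K) (l : List B) (u : W)
    (hu : l.length < cs.length (w⁻¹ * u)) :
    coord F K u (P.ρ (cs.wordProd l)⁻¹ (Cvec F K w hw)) = 0 := by
  classical
  induction l using List.reverseRecOn generalizing u with
  | nil =>
    have : u ≠ w := by rintro rfl; simp at hu
    simp [coord_Cvec, this]
  | append_singleton l i ih =>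
    simp only [List.length_append, List.length_singleton] at hu
    have h1 := cs.length_mul_simple (w⁻¹ * u) i
    rw [rho_inv_wordProd_concat, coord_rho, ih u (by omega),
      ih (u * cs.simple i) (by rw [← mul_assoc]; omega)]
    simp

theorem coord_rho_inv_wordProd (w : W) (hw : w ∈ K) (l : List B) (hl : cs.IsReduced l) :
    coord F K (w * cs.wordProd l) (P.ρ (cs.wordProd l)⁻¹ (Cvec F K w hw)) =
      P.pathCoeff l w := by
  classical
  induction l using List.reverseRecOn with
  | nil => simp [coord_Cvec, pathCoeff]
  | append_singleton l i ih =>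
    have hl' : cs.IsReduced l := by simpa using hl.take l.length
    have hlen := hl.eq
    simp only [List.length_append, List.length_singleton] at hlen
    rw [rho_inv_wordProd_concat, coord_rho,
      P.coord_rho_inv_wordProd_eq_zero w hw l _ (by rw [inv_mul_cancel_left]; omega),
      pathCoeff_concat, ← ih hl']
    simp [cs.wordProd_append, mul_assoc, mul_comm]

theorem pathCoeff_eq_of_isReduced {w : W} (hw : w ∈ K) {l l' : List B}
    (hl : cs.IsReduced l) (hl' : cs.IsReduced l') (h : cs.wordProd l = cs.wordProd l') :
    P.pathCoeff l w = P.pathCoeff l' w := by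
  rw [← P.coord_rho_inv_wordProd w hw l hl, ← P.coord_rho_inv_wordProd w hw l' hl', h]

theorem isReduced_concat {l : List B} {i : B} (hl : cs.IsReduced l)
    (h : cs.length (cs.wordProd l * cs.simple i) = cs.length (cs.wordProd l) + 1) :
    cs.IsReduced (l ++ [i]) := by
  unfold CoxeterSystem.IsReduced
  rw [cs.wordProd_append, cs.wordProd_singleton, h, hl.eq]
  simp

theorem exists_isReduced_pathCoeff_ne_zero {w : W} (hw : w ∈ K) {l : List B}
    (h : P.pathCoeff l w ≠ 0) :
    ∃ l', cs.IsReduced l' ∧ cs.wordProd l' = cs.wordProd l ∧ P.pathCoeff l' w ≠ 0 := by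
  induction l using List.reverseRecOn with
  | nil => exact ⟨[], by simp [CoxeterSystem.IsReduced], rfl, h⟩
  | append_singleton l i ih =>
    rw [pathCoeff_concat] at h
    obtain ⟨l', hr, he, hn⟩ := ih (left_ne_zero_of_mul h)
    have hoff := right_ne_zero_of_mul h
    rcases cs.length_mul_simple (cs.wordProd l') i with h1 | h1
    · refine ⟨l' ++ [i], isReduced_concat hr h1, ?_, ?_⟩
      · simp [cs.wordProd_append, he]
      · rw [pathCoeff_concat, he]
        exact mul_ne_zero hn hoff
    · obtain ⟨m, hm, hme⟩ := cs.exists_isReduced (cs.wordProd l' * cs.simple i)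
      have hmi : cs.wordProd (m ++ [i]) = cs.wordProd l' := by
        simp [cs.wordProd_append, ← hme]
      have hmr : cs.IsReduced (m ++ [i]) := by
        refine isReduced_concat hm ?_
        rw [← hme, cs.simple_mul_simple_cancel_right, h1]
      refine ⟨m, hm, ?_, ?_⟩
      · rw [← hme, he, cs.wordProd_append, cs.wordProd_singleton]
      · rw [P.pathCoeff_eq_of_isReduced hw hr hmr hmi.symm, pathCoeff_concat] at hn
        exact left_ne_zero_of_mul hn

variable {P}

theorem Minimal.exists_pathCoeff_ne_zero (hP : P.Minimal) {x y : W} (hx : x ∈ K)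
    (hy : y ∈ K) : ∃ l, x * cs.wordProd l = y ∧ P.pathCoeff l x ≠ 0 := by
  have hK := hP.2 {y | ∃ l, x * cs.wordProd l = y ∧ P.pathCoeff l x ≠ 0} ?_ ?_ ?_
  · rw [← hK] at hy
    exact hy
  · rintro _ ⟨l, rfl, hl⟩
    exact P.mem_of_pathCoeff_ne_zero hx hl
  · exact ⟨x, [], by simp, by simp [pathCoeff]⟩
  · intro g
    induction g using cs.simple_induction with
    | one => simp
    | mul g h hg hh =>
      intro v hv
      rw [map_mul]
      exact hg _ (hh _ hv)
    | simple i =>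
      intro v hv
      induction hv using Submodule.span_induction with
      | zero => simp
      | add a b _ _ ha hb => rw [map_add]; exact add_mem ha hb
      | smul c a _ ha => rw [map_smul]; exact Submodule.smul_mem _ c ha
      | mem v hv =>
        obtain ⟨w, hw, ⟨l, hl, hne⟩, rfl⟩ := hv
        have hmem : Cvec F K w hw ∈ spanOf F K
            {y | ∃ l, x * cs.wordProd l = y ∧ P.pathCoeff l x ≠ 0} :=
          Submodule.subset_span ⟨w, hw, ⟨l, hl, hne⟩, rfl⟩
        by_cases h : w * cs.simple i ∈ K
        · rw [P.rho_Cvec_mem i w hw h]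
          refine add_mem (Submodule.smul_mem _ _ hmem) ?_
          by_cases h0 : P.off i w = 0
          · simp [h0]
          · refine Submodule.smul_mem _ _ (Submodule.subset_span
              ⟨_, h, ⟨l ++ [i], ?_, ?_⟩, rfl⟩)
            · simp [cs.wordProd_append, ← hl, mul_assoc]
            · rw [pathCoeff_concat, hl]
              exact mul_ne_zero hne h0
        · rw [P.rho_Cvec_not_mem i w hw h]
          exact Submodule.smul_mem _ _ hmem

theorem Minimal.pathCoeff_ne_zero (hP : P.Minimal) {x : W} (hx : x ∈ K) {l : List B}
    (hl : cs.IsReduced l) (hy : x * cs.wordProd l ∈ K) : P.pathCoeff l x ≠ 0 := by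
  obtain ⟨m, hm, hne⟩ := hP.exists_pathCoeff_ne_zero hx hy
  obtain ⟨m', hr, he, hne'⟩ := P.exists_isReduced_pathCoeff_ne_zero hx hne
  rwa [P.pathCoeff_eq_of_isReduced hx hl hr (by rw [he, mul_left_cancel hm])]

theorem Minimal.off_ne_zero (hP : P.Minimal) {x : W} {i : B} (hx : x ∈ K)
    (hy : x * cs.simple i ∈ K) : P.off i x ≠ 0 := by
  simpa [pathCoeff] using
    hP.pathCoeff_ne_zero (l := [i]) hx (by simp [CoxeterSystem.IsReduced]) (by simpa using hy)

theorem Minimal.mul_simple_mem (hP : P.Minimal) (h1 : (1 : W) ∈ K) {x : W} {i : B}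
    (hx : x ∈ K) (hlt : cs.length (x * cs.simple i) < cs.length x) :
    x * cs.simple i ∈ K := by
  obtain ⟨m, hm, hme⟩ := cs.exists_isReduced (x * cs.simple i)
  have hlen := cs.length_mul_simple x i
  have hmr : cs.IsReduced (m ++ [i]) := by
    refine isReduced_concat hm ?_
    rw [← hme, cs.simple_mul_simple_cancel_right]
    omega
  have hne := hP.pathCoeff_ne_zero (l := m ++ [i]) h1 hmr
    (by simpa [cs.wordProd_append, ← hme] using hx)
  rw [pathCoeff_concat] at hne
  simpa [← hme] using P.mem_of_pathCoeff_ne_zero h1 (left_ne_zero_of_mul hne)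

theorem Minimal.length_lt (hP : P.Minimal) (h1 : (1 : W) ∈ K) {x : W} {i : B}
    (hx : x ∈ K) (hxi : x * cs.simple i ∉ K) :
    cs.length x < cs.length (x * cs.simple i) := by
  by_contra h
  exact hxi (hP.mul_simple_mem h1 hx (length_lt_of_not_lt h))

theorem rho_rho (i : B) (x : ↥K →₀ F) :
    P.ρ (cs.simple i) (P.ρ (cs.simple i) x) = x := by
  rw [← Module.End.mul_apply, ← map_mul]
  simp

theorem diag_mul_diag_add {x : W} {i : B} (hx : x ∈ K) :
    P.diag i x * P.diag i x + P.off i (x * cs.simple i) * P.off i x = 1 := by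
  classical
  have h := congrArg (coord F K x) (P.rho_rho i (Cvec F K x hx))
  simp only [coord_rho, coord_Cvec, cs.simple_mul_simple_cancel_right] at h
  have hne : x * cs.simple i ≠ x := fun e => cs.length_mul_simple_ne x i (congrArg _ e)
  simpa [hne] using h

theorem Minimal.diag_mul_simple (hP : P.Minimal) {x : W} {i : B} (hx : x ∈ K)
    (hy : x * cs.simple i ∈ K) : P.diag i (x * cs.simple i) = -P.diag i x := by
  classical
  have h := congrArg (coord F K (x * cs.simple i)) (P.rho_rho i (Cvec F K x hx))
  simp only [coord_rho, coord_Cvec, cs.simple_mul_simple_cancel_right] at h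
  have hne : x * cs.simple i ≠ x := fun e => cs.length_mul_simple_ne x i (congrArg _ e)
  simp only [hne, if_true, if_false, mul_zero, mul_one, zero_add, add_zero] at h
  have h2 := hP.off_ne_zero hx hy
  have h3 : P.off i x * (P.diag i (x * cs.simple i) + P.diag i x) = 0 := by
    linear_combination h
  exact eq_neg_of_add_eq_zero_left ((mul_eq_zero.mp h3).resolve_left h2)

theorem Minimal.diag_sq_ne_one (hP : P.Minimal) {x : W} {i : B} (hx : x ∈ K)
    (hy : x * cs.simple i ∈ K) : P.diag i x ^ 2 ≠ 1 := by
  intro h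
  have h1 := P.diag_mul_diag_add (i := i) hx
  have h2 := hP.off_ne_zero hx hy
  have h3 := hP.off_ne_zero (i := i) hy (by simpa using hx)
  exact mul_ne_zero h3 h2 (by linear_combination h1 - h)

theorem diag_sq_eq_one {x : W} {i : B} (hx : x ∈ K) (hy : x * cs.simple i ∉ K) :
    P.diag i x ^ 2 = 1 := by
  have h1 := P.diag_mul_diag_add (i := i) hx
  have h2 : P.off i x = 0 := by simp [off, hy]
  rw [h2] at h1
  linear_combination h1

theorem simple_braid {i j : B} (hij : M i j = 3) :
    cs.simple i * cs.simple j * cs.simple i = cs.simple j * cs.simple i * cs.simple j := by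
  have h := cs.simple_mul_simple_pow i j
  rw [hij, pow_succ, pow_two] at h
  have h' : (cs.simple i * cs.simple j * cs.simple i) *
      (cs.simple j * cs.simple i * cs.simple j) = 1 := by
    simpa [mul_assoc] using h
  rw [eq_comm, ← inv_inj, ← eq_inv_iff_mul_eq_one.mpr h']
  simp [mul_assoc]

theorem simple_comm {i j : B} (hij : M i j = 2) :
    cs.simple i * cs.simple j = cs.simple j * cs.simple i := by
  have h := cs.simple_mul_simple_pow i j
  rw [hij, pow_two] at h
  simpa using eq_inv_of_mul_eq_one_left h

theorem rho_braid {i j : B} (hij : M i j = 3) (x : ↥K →₀ F) :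
    P.ρ (cs.simple i) (P.ρ (cs.simple j) (P.ρ (cs.simple i) x)) =
      P.ρ (cs.simple j) (P.ρ (cs.simple i) (P.ρ (cs.simple j) x)) := by
  simp only [← Module.End.mul_apply, ← map_mul, ← mul_assoc, simple_braid hij]

theorem diag_eq_diag {x : W} {i j : B} (hx : x ∈ K) (hij : M i j = 3)
    (hi : x * cs.simple i ∉ K) (hj : x * cs.simple j ∉ K) : P.diag i x = P.diag j x := by
  classical
  have h := congrArg (coord F K x) (P.rho_braid hij (Cvec F K x hx))
  simp only [P.rho_Cvec_not_mem _ x hx hi, P.rho_Cvec_not_mem _ x hx hj, map_smul,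
    coord_Cvec, smul_eq_mul, if_true] at h
  have hi2 := P.diag_sq_eq_one hx hi
  have hj2 := P.diag_sq_eq_one hx hj
  linear_combination -h + P.diag j x * hi2 - P.diag i x * hj2

/-- The braid relation `ρ_r ρ_s ρ_r = ρ_s ρ_r ρ_s` compared at `C_{vr}` in the image of `C_v`,
for `v` the shortest element of its coset modulo `⟨r, s⟩`. -/
theorem Minimal.diag_braid (hP : P.Minimal) {v : W} {r s : B} (hrs : M r s = 3)
    (hv : v ∈ K) (hvr : v * cs.simple r ∈ K)
    (h1 : cs.length v < cs.length (v * cs.simple r))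
    (h2 : cs.length (v * cs.simple r) < cs.length (v * cs.simple r * cs.simple s)) :
    P.diag r v * P.diag s v =
      P.diag s (v * cs.simple r) * (P.diag r v + P.diag s v) := by
  classical
  have l1 := cs.length_mul_simple v r
  have l2 := cs.length_mul_simple (v * cs.simple r) s
  have l3 := cs.length_mul_simple (v * cs.simple r * cs.simple s) r
  have l4 := cs.length_mul_simple_ne v s
  have hb : v * cs.simple r * cs.simple s * cs.simple r * cs.simple s
      = v * cs.simple s * cs.simple r := by
    have := simple_braid (cs := cs) hrs
    calc _ = v * (cs.simple r * cs.simple s * cs.simple r) * cs.simple s := by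
          simp only [mul_assoc]
      _ = _ := by rw [this]; simp [mul_assoc]
  have e1 : v * cs.simple r ≠ v := fun e => by rw [e] at h1; omega
  have e2 : v * cs.simple r * cs.simple s ≠ v := fun e => by rw [e] at h2; omega
  have e3 : v * cs.simple r * cs.simple s * cs.simple r ≠ v := fun e => by
    rw [e] at l3; omega
  have e4 : v * cs.simple s ≠ v := fun e => l4 (by rw [e])
  have e5 : v * cs.simple s * cs.simple r ≠ v := fun e => by
    have : v * cs.simple r = v * cs.simple s := by
      nth_rewrite 1 [← e]
      simp
    apply e2
    rw [this]
    simp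
  have h := congrArg (coord F K (v * cs.simple r)) (P.rho_braid hrs (Cvec F K v hv))
  simp only [coord_rho, coord_Cvec, cs.simple_mul_simple_cancel_right, hb] at h
  simp only [e1, e2, e3, e4, e5, if_true, if_false, mul_zero, mul_one, zero_add,
    add_zero, hP.diag_mul_simple hv hvr] at h
  apply mul_left_cancel₀ (hP.off_ne_zero hv hvr)
  linear_combination h

theorem diag_eq_ad {x : W} {i : B} (h : cs.length x < cs.length (x * cs.simple i)) :
    P.diag i x = P.ad (x * cs.simple i * x⁻¹) := by
  simp [diag, h]

theorem Minimal.ad_ne_zero (hP : P.Minimal) (h1 : (1 : W) ∈ K)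
    (had : ∀ t ∈ TK cs K, P.ad t ≠ 0) {x : W} {i : B} (hx : x ∈ K) :
    P.ad (x * cs.simple i * x⁻¹) ≠ 0 := by
  by_cases h : x * cs.simple i ∈ K
  · exact had _ ⟨i, x, hx, h, rfl⟩
  · intro h0
    have := P.diag_sq_eq_one hx h
    rw [diag_eq_ad (hP.length_lt h1 hx h), h0] at this
    simp at this

end AYRepB

theorem bform_single [DecidableEq B] [Fintype B] (i j : B) :
    bform M (Pi.single i 1) (Pi.single j 1) = -Real.cos (Real.pi / (M i j : ℝ)) := by
  simp [bform, Pi.single_apply]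

theorem exists_dual_eq [DecidableEq B] [Fintype B]
    (ip : (B → ℝ) →ₗ[ℝ] (B → ℝ) →ₗ[ℝ] ℝ) (hpos : ∀ v : B → ℝ, v ≠ 0 → 0 < ip v v)
    (c : B → ℝ) : ∃ f : B → ℝ, ∀ i, ip f (Pi.single i 1) = c i := by
  have hinj : Function.Injective ip := by
    rw [injective_iff_map_eq_zero]
    intro v hv
    by_contra h
    simpa [hv] using hpos v h
  have hsurj : Function.Surjective ip :=
    (LinearMap.injective_iff_surjective_of_finrank_eq_finrank
      (Subspace.dual_finrank_eq (K := ℝ) (V := B → ℝ)).symm).mp hinj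
  obtain ⟨f, hf⟩ := hsurj ((Pi.basisFun ℝ B).constr ℝ c)
  refine ⟨f, fun i => ?_⟩
  rw [hf, ← Pi.basisFun_apply, Module.Basis.constr_basis]

/-- A functional taking the values `1 / ȧ_s` on the simple roots takes the value `1 / ȧ_t` on
every positive root `α_t = σ_w(α_s)` with `w ∈ K`. -/
theorem AYRepB.Minimal.functional_root_eq [DecidableEq B] [Fintype B]
    {cs : CoxeterSystem M W} {K : Set W} {P : AYRepB cs ℝ K} (hmin : P.Minimal)
    (hsl : SimplyLaced M) (h1K : (1 : W) ∈ K) (σ : Representation ℝ W (B → ℝ))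
    (hσ : ∀ (i : B) (v : B → ℝ),
      σ (cs.simple i) v = v - (2 * bform M v (Pi.single i 1 : B → ℝ)) • (Pi.single i 1 : B → ℝ))
    (had : ∀ t ∈ TK cs K, P.ad t ≠ 0) (f : (B → ℝ) →ₗ[ℝ] ℝ)
    (hf : ∀ i, f (Pi.single i 1) = (P.ad (cs.simple i))⁻¹) (w : W) (s : B) (hw : w ∈ K)
    (hlt : cs.length w < cs.length (w * cs.simple s)) :
    f (σ w (Pi.single s 1)) = (P.ad (w * cs.simple s * w⁻¹))⁻¹ := by
  induction hn : cs.length w using Nat.strong_induction_on generalizing w s with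
  | _ n ih =>
  subst hn
  by_cases hw1 : w = 1
  · simp [hw1, hf]
  obtain ⟨r, hr⟩ := cs.exists_rightDescent_of_ne_one hw1
  unfold CoxeterSystem.IsRightDescent at hr
  obtain ⟨v, rfl⟩ : ∃ v, w = v * cs.simple r := ⟨w * cs.simple r, by simp⟩
  have hvr := hw
  have hv : v ∈ K := by simpa using hmin.mul_simple_mem h1K hw hr
  simp only [cs.simple_mul_simple_cancel_right] at hr
  have hne : r ≠ s := by
    rintro rfl
    simp only [cs.simple_mul_simple_cancel_right] at hlt
    omega
  have l1 := cs.length_mul_simple v r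
  have l2 := cs.length_mul_simple (v * cs.simple r) s
  rcases hsl r s hne with h2 | h3
  · have hc := AYRepB.simple_comm (cs := cs) h2
    have hroot : σ (cs.simple r) (Pi.single s 1) = Pi.single s 1 := by
      rw [hσ, bform_single, M.symmetric s r, h2]
      simp
    have l3 := cs.length_mul_simple (v * cs.simple s) r
    rw [mul_assoc v, ← hc, ← mul_assoc v] at l3
    have := ih _ hr v s hv (by omega) rfl
    rw [map_mul, Module.End.mul_apply, hroot, this]
    congr 2
    rw [mul_assoc v (cs.simple r), hc]
    simp [mul_assoc]
  · have hroot : σ (cs.simple r) (Pi.single s 1) = Pi.single s 1 + Pi.single r 1 := by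
      rw [hσ, bform_single, M.symmetric s r, h3]
      simp
    have hroot' : σ (cs.simple s) (Pi.single r 1) = Pi.single r 1 + Pi.single s 1 := by
      rw [hσ, bform_single, h3]
      simp
    by_cases hvs : cs.length v < cs.length (v * cs.simple s)
    · have ihr := ih _ hr v r hv hr rfl
      have ihs := ih _ hr v s hv hvs rfl
      have hbr := hmin.diag_braid h3 hv hvr hr hlt
      rw [AYRepB.diag_eq_ad hr, AYRepB.diag_eq_ad hvs, AYRepB.diag_eq_ad hlt] at hbr
      have ha := hmin.ad_ne_zero h1K had (i := r) hv
      have hb := hmin.ad_ne_zero h1K had (i := s) hv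
      have hc := hmin.ad_ne_zero h1K had (i := s) hvr
      rw [map_mul, Module.End.mul_apply, hroot, map_add, map_add, ihr, ihs]
      field_simp
      linear_combination -hbr
    · have hvs' := AYRepB.length_lt_of_not_lt hvs
      obtain ⟨u, rfl⟩ : ∃ u, v = u * cs.simple s := ⟨v * cs.simple s, by simp⟩
      have hu : u ∈ K := by simpa using hmin.mul_simple_mem h1K hv hvs'
      simp only [cs.simple_mul_simple_cancel_right] at hvs'
      have hbraid := AYRepB.simple_braid (cs := cs) h3
      have hmul : u * cs.simple s * cs.simple r * cs.simple s
          = u * cs.simple r * cs.simple s * cs.simple r := by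
        simp only [mul_assoc] at hbraid ⊢
        rw [hbraid]
      have l3 := cs.length_mul_simple u s
      have l4 := cs.length_mul_simple u r
      have l5 := cs.length_mul_simple (u * cs.simple r) s
      have l6 := cs.length_mul_simple (u * cs.simple r * cs.simple s) r
      rw [hmul] at l2 hlt
      have := ih _ (by omega) u r hu (by omega) rfl
      have hroot2 : σ (cs.simple s) (Pi.single s 1 + Pi.single r 1) = Pi.single r 1 := by
        rw [add_comm, ← hroot', ← Module.End.mul_apply, ← map_mul]
        simp
      rw [map_mul, Module.End.mul_apply, hroot, map_mul, Module.End.mul_apply, hroot2, this,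
        hmul]
      congr 2
      simp [mul_assoc]

/-- for an irreducible simply laced Coxeter system and `K ∋ 1`, the
coefficients `ȧ_t` of a minimal AY pair satisfying Axiom (B) with `ȧ_t ≠ 0` on `T_K`
come from a `K`-generic linear functional: `ȧ_t = 1/⟨f,α_t⟩` on `T_K ∪ T_∂K`. -/
theorem stmt15 [DecidableEq B] [Fintype B] (cs : CoxeterSystem M W)
    (hsl : SimplyLaced M) (hirr : IrreducibleCox M)
    (K : Set W) (h1K : (1 : W) ∈ K)
    -- the standard geometric representation σ of W on the root space V = B → ℝ
    (σ : Representation ℝ W (B → ℝ))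
    (hσ : ∀ (i : B) (v : B → ℝ),
      σ (cs.simple i) v = v - (2 * bform M v (Pi.single i 1 : B → ℝ)) • (Pi.single i 1 : B → ℝ))
    -- an arbitrary positive definite bilinear form ⟨·,·⟩ on V
    (ip : (B → ℝ) →ₗ[ℝ] (B → ℝ) →ₗ[ℝ] ℝ)
    (hsymm : ∀ u v : B → ℝ, ip u v = ip v u)
    (hpos : ∀ v : B → ℝ, v ≠ 0 → 0 < ip v v)
    -- the positive root α_t associated to each reflection t
    (αT : W → (B → ℝ))
    (hαT : ∀ (w : W) (i : B), cs.length w < cs.length (w * cs.simple i) →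
      αT (w * cs.simple i * w⁻¹) = σ w (Pi.single i 1 : B → ℝ))
    (P : AYRepB cs ℝ K) (hmin : P.Minimal)
    (had : ∀ t ∈ TK cs K, P.ad t ≠ 0) :
    ∃ f : B → ℝ, KGeneric cs K ip αT f ∧
      ∀ t ∈ TK cs K ∪ TbK cs K, P.ad t = (ip f (αT t))⁻¹ := by
  obtain ⟨f, hf⟩ := exists_dual_eq ip hpos fun i => (P.ad (cs.simple i))⁻¹
  have key : ∀ (w : W) (i : B), w ∈ K → cs.length w < cs.length (w * cs.simple i) →
      ip f (αT (w * cs.simple i * w⁻¹)) = (P.diag i w)⁻¹ := fun w i hw hlt => by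
    rw [hαT w i hlt, hmin.functional_root_eq hsl h1K σ hσ had (ip f) hf w i hw hlt,
      AYRepB.diag_eq_ad hlt]
  have hTK : ∀ t ∈ TK cs K, ∃ (i : B) (w : W), w ∈ K ∧ w * cs.simple i ∈ K ∧
      cs.length w < cs.length (w * cs.simple i) ∧ t = w * cs.simple i * w⁻¹ := by
    rintro t ⟨i, w, hw, hwi, rfl⟩
    by_cases hlt : cs.length w < cs.length (w * cs.simple i)
    · exact ⟨i, w, hw, hwi, hlt, rfl⟩
    · refine ⟨i, w * cs.simple i, hwi, by simpa using hw, ?_, by simp [mul_assoc]⟩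
      simpa using AYRepB.length_lt_of_not_lt hlt
  refine ⟨f, ⟨?_, ?_, ?_⟩, ?_⟩
  · intro t ht
    obtain ⟨i, w, hw, hwi, hlt, rfl⟩ := hTK t ht
    have h0 := had _ ht
    rw [← AYRepB.diag_eq_ad hlt] at h0
    have h1 := hmin.diag_sq_ne_one hw hwi
    rw [key w i hw hlt]
    refine ⟨inv_ne_zero h0, fun h => h1 ?_, fun h => h1 ?_⟩
    · rw [inv_eq_one.mp h, one_pow]
    · rw [inv_eq_iff_eq_inv.mp h]
      norm_num
  · rintro t ⟨i, w, hw, hwi, rfl⟩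
    rw [key w i hw (hmin.length_lt h1K hw hwi)]
    have h : P.diag i w = 1 ∨ P.diag i w = -1 := by simpa using P.diag_sq_eq_one hw hwi
    rcases h with h | h <;> simp [h]
  · intro w hw i j hij hi hj
    rw [key w i hw (hmin.length_lt h1K hw hi), key w j hw (hmin.length_lt h1K hw hj),
      P.diag_eq_diag hw hij hi hj]
  · rintro t (ht | ⟨i, w, hw, hwi, rfl⟩)
    · obtain ⟨i, w, hw, hwi, hlt, rfl⟩ := hTK t ht
      rw [key w i hw hlt, inv_inv, AYRepB.diag_eq_ad hlt]
    · have hlt := hmin.length_lt h1K hw hwi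
      rw [key w i hw hlt, inv_inv, AYRepB.diag_eq_ad hlt]
end
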